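/- Let Ω ⊂ ℝ² be a bounded, simply connected domain with smooth boundary, let β ∈ (0,1), let 0 < α < min{1/7, β/2}, and let A ∈ C^{0,β}(Ω̄, ℝ^{2×2}_sym). Let v ∈ C¹(Ω̄, ℝ) and w ∈ C¹(Ω̄, ℝ²) be such that 2 sym∇w + ∇v⊗∇v ≤ A − cI in the sense of symmetric matrices pointwise on Ω, for some constant c > 0, and let ε > 0. Then there exist v̄ ∈ C^{1,α}(Ω̄, ℝ) and w̄ ∈ C^{1,α}(Ω̄, ℝ²) with ‖w̄ − w‖_{C⁰(Ω)} + ‖v̄ − v‖_{C⁰(Ω)} ≤ ε and such that 2 sym∇w̄ + ∇v̄⊗∇v̄ = A on Ω. -/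

import Mathlib

open MeasureTheory Matrix Topology

noncomputable section

abbrev V2 := Fin 2 → ℝ
abbrev Mat2 := Matrix (Fin 2) (Fin 2) ℝ

/-- Partial derivative `∂ᵢ f`. -/
def pd (i : Fin 2) (f : V2 → ℝ) (x : V2) : ℝ := fderiv ℝ f x (Pi.single i 1)

/-- Gradient of a scalar function. -/
def grad (f : V2 → ℝ) (x : V2) : V2 := fun i => pd i f x

/-- `∇v ⊗ ∇v`. -/
def gradOuter (v : V2 → ℝ) (x : V2) : Mat2 := Matrix.of fun i j => pd i v x * pd j v x

/-- Derivative matrix `(∇w)ᵢⱼ = ∂ⱼwᵢ`. -/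
def Dm (w : V2 → V2) (x : V2) : Mat2 := Matrix.of fun i j => fderiv ℝ w x (Pi.single j 1) i

/-- Symmetrised gradient `sym ∇w = (∇w + (∇w)ᵀ)/2`. -/
def symGrad (w : V2 → V2) (x : V2) : Mat2 := (1/2 : ℝ) • (Dm w x + (Dm w x)ᵀ)

/-- Frobenius norm of a matrix. -/
def frob (M : Mat2) : ℝ := Real.sqrt (∑ i, ∑ j, (M i j)^2)

/-- Euclidean norm on ℝ². -/
def norm2 (y : V2) : ℝ := Real.sqrt (∑ i, (y i)^2)

/-- Supremum norm over `Ω` of a matrix field. -/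
def supM (Ω : Set V2) (M : V2 → Mat2) : ℝ := ⨆ x : Ω, frob (M x)

/-- Supremum norm over `Ω` of a vector field. -/
def supV (Ω : Set V2) (f : V2 → V2) : ℝ := ⨆ x : Ω, norm2 (f x)

/-- `L^p` norm over `Ω` of a matrix field. -/
def lpM (p : ℝ) (Ω : Set V2) (M : V2 → Mat2) : ℝ := (∫ x in Ω, frob (M x) ^ p) ^ (1/p)

/-- `f ∈ C^k(Ω̄)`: `f` is `C^k` on an open neighbourhood of the closure of `Ω`. -/
def CkCl (k : ℕ∞) (Ω : Set V2) {F : Type*} [NormedAddCommGroup F] [NormedSpace ℝ F]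
    (f : V2 → F) : Prop :=
  ∃ U : Set V2, IsOpen U ∧ closure Ω ⊆ U ∧ ContDiffOn ℝ k f U

/-- `A ∈ C^{0,β}(Ω̄)`: `A` is `β`-Hölder continuous on the closure of `Ω`. -/
def HolderCl (β : ℝ) (Ω : Set V2) (A : V2 → Mat2) : Prop :=
  ∃ C : ℝ, ∀ x ∈ closure Ω, ∀ y ∈ closure Ω, frob (A x - A y) ≤ C * norm2 (x - y) ^ β

/-- `f ∈ C^{1,α}(Ω̄)`: continuously differentiable with `α`-Hölder gradient. -/
def C1Holder (α : ℝ) (Ω : Set V2) {F : Type*} [NormedAddCommGroup F] [NormedSpace ℝ F]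
    (f : V2 → F) : Prop :=
  ContinuousOn f (closure Ω) ∧ DifferentiableOn ℝ f Ω ∧
    ∃ C : ℝ, ∀ x ∈ Ω, ∀ y ∈ Ω, ‖fderiv ℝ f x - fderiv ℝ f y‖ ≤ C * norm2 (x - y) ^ α

/-- `Ω` has smooth boundary: it is the sublevel set of a smooth function with
nonvanishing gradient on the boundary. -/
def HasSmoothBoundary (Ω : Set V2) : Prop :=
  ∃ ρ : V2 → ℝ, ContDiff ℝ (⊤ : ℕ∞) ρ ∧ Ω = ρ ⁻¹' Set.Iio 0 ∧
    ∀ x ∈ frontier Ω, fderiv ℝ ρ x ≠ 0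

/-- Supremum norm over `Ω` of a scalar field. -/
def supS (Ω : Set V2) (f : V2 → ℝ) : ℝ := ⨆ x : Ω, |f x|


/-- Smoothness shorthand. -/
def Sm (f : V2 → ℝ) : Prop := ContDiff ℝ (⊤ : ℕ∞) f

/-- Weighted derivative bounds: `‖D^j f‖ ≤ c μ^j` for `j ≤ n`. -/
def SB (n : ℕ) (c μ : ℝ) (f : V2 → ℝ) : Prop :=
  Sm f ∧ ∀ j ≤ n, ∀ x, ‖iteratedFDeriv ℝ j f x‖ ≤ c * μ ^ j

lemma natle (j : ℕ) : ((j : ℕ∞) : WithTop ℕ∞) ≤ ((⊤ : ℕ∞) : WithTop ℕ∞) := by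
  exact_mod_cast (le_top : (j : ℕ∞) ≤ ⊤)

lemma Sm.diff {f : V2 → ℝ} (h : Sm f) (x : V2) : DifferentiableAt ℝ f x :=
  (ContDiff.differentiable h (by simp)) x

lemma Sm.cont {f : V2 → ℝ} (h : Sm f) : Continuous f := ContDiff.continuous h

lemma Sm.add {f g : V2 → ℝ} (hf : Sm f) (hg : Sm g) : Sm (fun x => f x + g x) := ContDiff.add hf hg
lemma Sm.sub {f g : V2 → ℝ} (hf : Sm f) (hg : Sm g) : Sm (fun x => f x - g x) := ContDiff.sub hf hg
lemma Sm.mul {f g : V2 → ℝ} (hf : Sm f) (hg : Sm g) : Sm (fun x => f x * g x) := ContDiff.mul hf hg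
lemma Sm.const (c : ℝ) : Sm (fun _ => c) := contDiff_const

lemma Sm.pd {f : V2 → ℝ} (h : Sm f) (i : Fin 2) : Sm (pd i f) := by
  have h1 : ContDiff ℝ (⊤ : ℕ∞) (fderiv ℝ f) := ContDiff.fderiv_right h (by simp)
  exact h1.clm_apply contDiff_const

lemma SB.mono_n {n m : ℕ} {c μ : ℝ} {f : V2 → ℝ} (h : SB n c μ f) (hm : m ≤ n) : SB m c μ f :=
  ⟨h.1, fun j hj x => h.2 j (hj.trans hm) x⟩

lemma SB.mono {n : ℕ} {c c' μ μ' : ℝ} {f : V2 → ℝ} (h : SB n c μ f) (hc : c ≤ c')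
    (hc0 : 0 ≤ c') (hμ0 : 0 ≤ μ) (hμ : μ ≤ μ') : SB n c' μ' f :=
  ⟨h.1, fun j hj x => (h.2 j hj x).trans (by gcongr)⟩

lemma SB.abs_le {n : ℕ} {c μ : ℝ} {f : V2 → ℝ} (h : SB n c μ f) (x : V2) : |f x| ≤ c := by
  have := h.2 0 (Nat.zero_le _) x
  simpa using this

lemma SB.nonneg {n : ℕ} {c μ : ℝ} {f : V2 → ℝ} (h : SB n c μ f) : 0 ≤ c :=
  (abs_nonneg _).trans (h.abs_le 0)

lemma SB.add {n : ℕ} {c d μ : ℝ} {f g : V2 → ℝ} (hf : SB n c μ f) (hg : SB n d μ g) :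
    SB n (c + d) μ (fun x => f x + g x) := by
  refine ⟨hf.1.add hg.1, fun j hj x => ?_⟩
  have e : iteratedFDeriv ℝ j (fun x => f x + g x) x
      = iteratedFDeriv ℝ j f x + iteratedFDeriv ℝ j g x :=
    iteratedFDeriv_add_apply ((ContDiff.of_le hf.1 (natle j)).contDiffAt)
      ((ContDiff.of_le hg.1 (natle j)).contDiffAt)
  rw [e, add_mul]
  exact (norm_add_le _ _).trans (add_le_add (hf.2 j hj x) (hg.2 j hj x))

lemma SB.smul {n : ℕ} {c μ : ℝ} {f : V2 → ℝ} (k : ℝ) (hf : SB n c μ f) :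
    SB n (|k| * c) μ (fun x => k * f x) := by
  refine ⟨(Sm.const k).mul hf.1, fun j hj x => ?_⟩
  have e : iteratedFDeriv ℝ j (fun x => k * f x) x = k • iteratedFDeriv ℝ j f x :=
    iteratedFDeriv_const_smul_apply (a := k) ((ContDiff.of_le hf.1 (natle j)).contDiffAt)
  rw [e, norm_smul, mul_assoc, Real.norm_eq_abs]
  exact mul_le_mul_of_nonneg_left (hf.2 j hj x) (abs_nonneg _)

lemma SB.neg {n : ℕ} {c μ : ℝ} {f : V2 → ℝ} (hf : SB n c μ f) :
    SB n c μ (fun x => - f x) := by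
  simpa using hf.smul (-1)

lemma SB.sub {n : ℕ} {c d μ : ℝ} {f g : V2 → ℝ} (hf : SB n c μ f) (hg : SB n d μ g) :
    SB n (c + d) μ (fun x => f x - g x) := by
  simpa [sub_eq_add_neg] using hf.add hg.neg

/-- pointwise Leibniz bound -/
lemma leib {f g : V2 → ℝ} (hf : Sm f) (hg : Sm g) (x : V2) (j : ℕ) {c d μ : ℝ} (hμ : 0 ≤ μ)
    (hc : ∀ i ≤ j, ‖iteratedFDeriv ℝ i f x‖ ≤ c * μ ^ i)
    (hd : ∀ i ≤ j, ‖iteratedFDeriv ℝ i g x‖ ≤ d * μ ^ i) :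
    ‖iteratedFDeriv ℝ j (fun x => f x * g x) x‖ ≤ 2 ^ j * (c * d) * μ ^ j := by
  have hc0 : 0 ≤ c := by simpa using (norm_nonneg _).trans (hc 0 (Nat.zero_le _))
  refine (norm_iteratedFDeriv_mul_le hf hg x (natle j)).trans ?_
  have : ∀ i ∈ Finset.range (j + 1), (j.choose i : ℝ) * ‖iteratedFDeriv ℝ i f x‖ *
      ‖iteratedFDeriv ℝ (j - i) g x‖ ≤ (j.choose i : ℝ) * (c * d * μ ^ j) := by
    intro i hi
    have hi' : i ≤ j := by simpa [Nat.lt_succ_iff] using hi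
    have e : μ ^ j = μ ^ i * μ ^ (j - i) := by rw [← pow_add]; congr 1; omega
    calc _ = (j.choose i : ℝ) * (‖iteratedFDeriv ℝ i f x‖ * ‖iteratedFDeriv ℝ (j - i) g x‖) := by
            ring
      _ ≤ (j.choose i : ℝ) * ((c * μ ^ i) * (d * μ ^ (j - i))) := by
            gcongr
            · exact hc i hi'
            · exact hd _ (Nat.sub_le _ _)
      _ = _ := by rw [e]; ring
  refine (Finset.sum_le_sum this).trans (le_of_eq ?_)
  rw [← Finset.sum_mul]
  have := Nat.sum_range_choose j
  have h2 : (∑ i ∈ Finset.range (j + 1), (j.choose i : ℝ)) = 2 ^ j := by exact_mod_cast this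
  rw [h2]; ring

lemma SB.mul {n : ℕ} {c d μ : ℝ} {f g : V2 → ℝ} (hμ : 0 ≤ μ) (hf : SB n c μ f) (hg : SB n d μ g) :
    SB n (2 ^ n * (c * d)) μ (fun x => f x * g x) := by
  refine ⟨hf.1.mul hg.1, fun j hj x => ?_⟩
  refine (leib hf.1 hg.1 x j hμ (fun i hi => hf.2 i (hi.trans hj) x)
    (fun i hi => hg.2 i (hi.trans hj) x)).trans ?_
  have := hf.nonneg
  have := hg.nonneg
  gcongr
  norm_num

lemma norm_single (i : Fin 2) : ‖(Pi.single i 1 : V2)‖ = 1 := by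
  rw [Pi.norm_single, norm_one]

lemma SB.pd {n : ℕ} {c μ : ℝ} {f : V2 → ℝ} (hf : SB (n + 1) c μ f) (i : Fin 2) :
    SB n (c * μ) μ (pd i f) := by
  refine ⟨hf.1.pd i, fun j hj x => ?_⟩
  have h1 : ContDiff ℝ (⊤ : ℕ∞) (fderiv ℝ f) := ContDiff.fderiv_right hf.1 (by simp)
  have := norm_iteratedFDeriv_clm_apply_const (𝕜 := ℝ) (f := fderiv ℝ f)
    (c := (Pi.single i 1 : V2)) (x := x) (n := j) (N := ((⊤ : ℕ∞) : WithTop ℕ∞))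
    h1.contDiffAt (natle j)
  rw [norm_single, one_mul, norm_iteratedFDeriv_fderiv] at this
  refine this.trans ((hf.2 (j + 1) (by omega) x).trans (le_of_eq ?_))
  rw [pow_succ]; ring

lemma vec_decomp (y : V2) : y = y 0 • (Pi.single 0 1 : V2) + y 1 • (Pi.single 1 1 : V2) := by
  ext k; fin_cases k <;> simp

lemma fderiv_eq_pd (f : V2 → ℝ) (x y : V2) : fderiv ℝ f x y = y 0 * pd 0 f x + y 1 * pd 1 f x := by
  conv_lhs => rw [vec_decomp y]
  simp [pd]

lemma norm_fderiv_le (f : V2 → ℝ) (x : V2) : ‖fderiv ℝ f x‖ ≤ |pd 0 f x| + |pd 1 f x| := by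
  refine ContinuousLinearMap.opNorm_le_bound _ (by positivity) fun y => ?_
  rw [fderiv_eq_pd, Real.norm_eq_abs]
  have h0 : |y 0| ≤ ‖y‖ := norm_le_pi_norm y 0
  have h1 : |y 1| ≤ ‖y‖ := norm_le_pi_norm y 1
  calc _ ≤ |y 0 * pd 0 f x| + |y 1 * pd 1 f x| := abs_add_le _ _
    _ = |y 0| * |pd 0 f x| + |y 1| * |pd 1 f x| := by rw [abs_mul, abs_mul]
    _ ≤ ‖y‖ * |pd 0 f x| + ‖y‖ * |pd 1 f x| := by gcongr
    _ = _ := by ring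

lemma lip_of_pd {f : V2 → ℝ} (hf : Differentiable ℝ f) {L : ℝ} (h : ∀ i x, |pd i f x| ≤ L)
    (x y : V2) : |f x - f y| ≤ 2 * L * ‖x - y‖ := by
  have := Convex.norm_image_sub_le_of_norm_fderiv_le (𝕜 := ℝ) (f := f) (C := 2 * L) (s := Set.univ)
    (fun z _ => hf z) (fun z _ => (norm_fderiv_le f z).trans (by linarith [h 0 z, h 1 z]))
    convex_univ (Set.mem_univ y) (Set.mem_univ x)
  simpa using this

lemma SB.lip {n : ℕ} {c μ : ℝ} {f : V2 → ℝ} (hf : SB (n + 1) c μ f) (x y : V2) :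
    |f x - f y| ≤ c * μ * ‖x - y‖ := by
  have := Convex.norm_image_sub_le_of_norm_fderiv_le (𝕜 := ℝ) (f := f) (C := c * μ) (s := Set.univ)
    (fun z _ => hf.1.diff z) (fun z _ => by
      have := hf.2 1 (by omega) z
      rw [norm_iteratedFDeriv_one] at this
      simpa using this)
    convex_univ (Set.mem_univ y) (Set.mem_univ x)
  simpa using this

lemma pd_add {f g : V2 → ℝ} {x : V2} (hf : DifferentiableAt ℝ f x) (hg : DifferentiableAt ℝ g x)
    (i : Fin 2) : pd i (fun x => f x + g x) x = pd i f x + pd i g x := by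
  simp only [pd]; rw [fderiv_fun_add hf hg]; rfl

lemma pd_sub {f g : V2 → ℝ} {x : V2} (hf : DifferentiableAt ℝ f x) (hg : DifferentiableAt ℝ g x)
    (i : Fin 2) : pd i (fun x => f x - g x) x = pd i f x - pd i g x := by
  simp only [pd]; rw [fderiv_fun_sub hf hg]; rfl

lemma pd_mul {f g : V2 → ℝ} {x : V2} (hf : DifferentiableAt ℝ f x) (hg : DifferentiableAt ℝ g x)
    (i : Fin 2) : pd i (fun x => f x * g x) x = f x * pd i g x + g x * pd i f x := by
  simp only [pd]; rw [fderiv_fun_mul hf hg]; simp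

lemma pd_const_mul {f : V2 → ℝ} {x : V2} (k : ℝ) (hf : DifferentiableAt ℝ f x)
    (i : Fin 2) : pd i (fun x => k * f x) x = k * pd i f x := by
  simp only [pd]; rw [fderiv_const_mul hf]; simp

/-- linear phase -/
def phase (ξ : V2) : V2 →L[ℝ] ℝ :=
  ξ 0 • ContinuousLinearMap.proj 0 + ξ 1 • ContinuousLinearMap.proj 1

lemma phase_apply (ξ x : V2) : phase ξ x = ξ 0 * x 0 + ξ 1 * x 1 := by simp [phase]

lemma phase_single (ξ : V2) (i : Fin 2) : phase ξ (Pi.single i 1) = ξ i := by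
  fin_cases i <;> simp [phase_apply]

lemma norm_phase (ξ : V2) {X : ℝ} (h : ∀ i, |ξ i| ≤ X) : ‖phase ξ‖ ≤ 2 * X := by
  have hX : 0 ≤ X := (abs_nonneg _).trans (h 0)
  refine ContinuousLinearMap.opNorm_le_bound _ (by positivity) fun y => ?_
  rw [phase_apply, Real.norm_eq_abs]
  have h0 : |y 0| ≤ ‖y‖ := norm_le_pi_norm y 0
  have h1 : |y 1| ≤ ‖y‖ := norm_le_pi_norm y 1
  calc _ ≤ |ξ 0| * |y 0| + |ξ 1| * |y 1| := by rw [← abs_mul, ← abs_mul]; exact abs_add_le _ _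
    _ ≤ X * ‖y‖ + X * ‖y‖ := by gcongr <;> exact h _
    _ = _ := by ring

lemma sin_bd (i : ℕ) (t : ℝ) : ‖iteratedFDeriv ℝ i Real.sin t‖ ≤ 1 := by
  rw [norm_iteratedFDeriv_eq_norm_iteratedDeriv]
  rcases Nat.even_or_odd' i with ⟨k, rfl | rfl⟩
  · rw [Real.iteratedDeriv_even_sin]
    simp only [Pi.mul_apply, Pi.pow_apply, Pi.neg_apply, Pi.one_apply, norm_mul, norm_pow, norm_neg,
      norm_one, one_pow, one_mul]
    exact Real.abs_sin_le_one t
  · rw [Real.iteratedDeriv_odd_sin]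
    simp only [Pi.mul_apply, Pi.pow_apply, Pi.neg_apply, Pi.one_apply, norm_mul, norm_pow, norm_neg,
      norm_one, one_pow, one_mul]
    exact Real.abs_cos_le_one t

lemma phase_bd (L : V2 →L[ℝ] ℝ) (x : V2) {D : ℝ} (hL : ‖L‖ ≤ D) (i : ℕ) (hi : 1 ≤ i) :
    ‖iteratedFDeriv ℝ i (fun x => L x) x‖ ≤ D ^ i := by
  have hD : 0 ≤ D := (norm_nonneg _).trans hL
  obtain ⟨k, rfl⟩ : ∃ k, i = k + 1 := ⟨i - 1, by omega⟩
  rw [← norm_iteratedFDeriv_fderiv]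
  have e : fderiv ℝ (fun x => L x) = fun _ => L := by
    ext1 z; exact L.fderiv
  rw [e]
  rcases Nat.eq_zero_or_pos k with rfl | hk
  · simpa using hL
  · rw [iteratedFDeriv_const_of_ne (by omega)]
    simp only [Pi.zero_apply, norm_zero]; positivity

lemma SB_sin (L : V2 →L[ℝ] ℝ) {D lam : ℝ} (hD : 1 ≤ D) (hlam : 0 ≤ lam) (hL : ‖L‖ ≤ D) :
    SB 3 (6 * D ^ 3) lam (fun x => Real.sin (lam * L x)) := by
  refine ⟨by unfold Sm; fun_prop, fun j hj x => ?_⟩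
  have hL' : ‖lam • L‖ ≤ lam * D := by
    rw [norm_smul, Real.norm_eq_abs, abs_of_nonneg hlam]; gcongr
  have := norm_iteratedFDeriv_comp_le (𝕜 := ℝ) (g := Real.sin) (f := fun x => (lam • L) x)
    (N := ((⊤ : ℕ∞) : WithTop ℕ∞)) (n := j) Real.contDiff_sin (lam • L).contDiff (natle j) x
    (C := 1) (D := lam * D) (fun i _ => sin_bd i _)
    (fun i hi _ => phase_bd _ x hL' i hi)
  refine le_trans (le_of_eq ?_) (this.trans ?_)
  · rfl
  · rw [mul_pow]
    have h1 : (j.factorial : ℝ) ≤ 6 := by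
      have : j.factorial ≤ Nat.factorial 3 := Nat.factorial_le hj
      exact_mod_cast this
    have h2 : D ^ j ≤ D ^ 3 := pow_le_pow_right₀ hD hj
    calc _ = (j.factorial : ℝ) * D ^ j * lam ^ j := by ring
      _ ≤ _ := by gcongr

lemma pd_sin (L : V2 →L[ℝ] ℝ) (lam : ℝ) (x : V2) (i : Fin 2) :
    pd i (fun x => Real.sin (lam * L x)) x = Real.cos (lam * L x) * (lam * L (Pi.single i 1)) := by
  have h1 : HasFDerivAt (fun x => lam * L x) (lam • L) x := (L.hasFDerivAt).const_mul lam
  have h2 := h1.sin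
  simp only [pd]
  rw [h2.fderiv]; simp

/-- The von Karman form in components. -/
def Df (v : V2 → ℝ) (w : Fin 2 → V2 → ℝ) (i j : Fin 2) (x : V2) : ℝ :=
  pd i (w j) x + pd j (w i) x + pd i v x * pd j v x

def corV (v b : V2 → ℝ) (ξ : V2) (lam : ℝ) (x : V2) : ℝ :=
  v x + lam⁻¹ * (b x * Real.sin (lam * phase ξ x))

def corW (v : V2 → ℝ) (w : Fin 2 → V2 → ℝ) (b : V2 → ℝ) (ξ : V2) (lam : ℝ) (j : Fin 2) (x : V2) : ℝ :=
  w j x + (-lam⁻¹ * (b x * Real.sin (lam * phase ξ x) * pd j v x) +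
    (-(lam⁻¹ / 8 * ξ j)) * (b x * b x * Real.sin (lam * ((2 : ℝ) • phase ξ) x)))

lemma sm_sin (L : V2 →L[ℝ] ℝ) (lam : ℝ) : Sm (fun x => Real.sin (lam * L x)) := by
  unfold Sm; fun_prop

lemma sm_corV {v b : V2 → ℝ} (hv : Sm v) (hb : Sm b) (ξ : V2) (lam : ℝ) : Sm (corV v b ξ lam) :=
  hv.add ((Sm.const _).mul (hb.mul (sm_sin _ _)))

lemma sm_corW {v b : V2 → ℝ} {w : Fin 2 → V2 → ℝ} (hv : Sm v) (hw : ∀ j, Sm (w j)) (hb : Sm b)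
    (ξ : V2) (lam : ℝ) (j : Fin 2) : Sm (corW v w b ξ lam j) :=
  (hw j).add (((Sm.const _).mul ((hb.mul (sm_sin _ _)).mul (hv.pd j))).add
    ((Sm.const _).mul ((hb.mul hb).mul (sm_sin _ _))))

lemma pd_corV {v b : V2 → ℝ} (hv : Sm v) (hb : Sm b) (ξ : V2) {lam : ℝ} (hl : lam ≠ 0)
    (i : Fin 2) (x : V2) : pd i (corV v b ξ lam) x =
      pd i v x + b x * Real.cos (lam * phase ξ x) * ξ i
        + lam⁻¹ * pd i b x * Real.sin (lam * phase ξ x) := by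
  have hs := sm_sin (phase ξ) lam
  unfold corV
  rw [pd_add (hv.diff x) (((Sm.const _).mul (hb.mul hs)).diff x),
    pd_const_mul _ ((hb.mul hs).diff x), pd_mul (hb.diff x) (hs.diff x), pd_sin, phase_single]
  field_simp
  ring

lemma pd_corW {v b : V2 → ℝ} {w : Fin 2 → V2 → ℝ} (hv : Sm v) (hw : ∀ j, Sm (w j)) (hb : Sm b)
    (ξ : V2) {lam : ℝ} (hl : lam ≠ 0) (i j : Fin 2) (x : V2) :
    pd i (corW v w b ξ lam j) x = pd i (w j) x
      - (b x * Real.cos (lam * phase ξ x) * ξ i + lam⁻¹ * pd i b x * Real.sin (lam * phase ξ x))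
          * pd j v x
      - lam⁻¹ * b x * Real.sin (lam * phase ξ x) * pd i (pd j v) x
      - b x ^ 2 / 4 * (2 * Real.cos (lam * phase ξ x) ^ 2 - 1) * (ξ i * ξ j)
      - lam⁻¹ / 2 * b x * pd i b x * ξ j
          * (Real.sin (lam * phase ξ x) * Real.cos (lam * phase ξ x)) := by
  have hs := sm_sin (phase ξ) lam
  have hs2 := sm_sin ((2 : ℝ) • phase ξ) lam
  have h1 := (hb.mul hs).mul (hv.pd j)
  have h2 := (hb.mul hb).mul hs2
  unfold corW
  rw [pd_add ((hw j).diff x) ((((Sm.const _).mul h1).add ((Sm.const _).mul h2)).diff x),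
    pd_add (((Sm.const _).mul h1).diff x) (((Sm.const _).mul h2).diff x),
    pd_const_mul _ (h1.diff x), pd_const_mul _ (h2.diff x),
    pd_mul ((hb.mul hs).diff x) ((hv.pd j).diff x), pd_mul (hb.diff x) (hs.diff x),
    pd_mul ((hb.mul hb).diff x) (hs2.diff x), pd_mul (hb.diff x) (hb.diff x), pd_sin, pd_sin]
  have e : lam * ((2 : ℝ) • phase ξ) x = 2 * (lam * phase ξ x) := by
    simp [smul_eq_mul]; ring
  have e2 : ((2 : ℝ) • phase ξ) (Pi.single i 1) = 2 * ξ i := by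
    simp [phase_single]
  rw [e, e2, phase_single, Real.sin_two_mul, Real.cos_two_mul]
  field_simp
  ring

lemma Df_cor {v b : V2 → ℝ} {w : Fin 2 → V2 → ℝ} (hv : Sm v) (hw : ∀ j, Sm (w j)) (hb : Sm b)
    (ξ : V2) {lam : ℝ} (hl : lam ≠ 0) (i j : Fin 2) (x : V2) :
    Df (corV v b ξ lam) (corW v w b ξ lam) i j x - Df v w i j x - b x ^ 2 / 2 * (ξ i * ξ j) =
      - (lam⁻¹ * b x * Real.sin (lam * phase ξ x) * (pd i (pd j v) x + pd j (pd i v) x))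
      + lam⁻¹ / 2 * b x * (Real.sin (lam * phase ξ x) * Real.cos (lam * phase ξ x))
          * (pd i b x * ξ j + pd j b x * ξ i)
      + (lam⁻¹ * lam⁻¹) * (pd i b x * pd j b x) * (Real.sin (lam * phase ξ x)) ^ 2 := by
  unfold Df
  rw [pd_corV hv hb ξ hl, pd_corV hv hb ξ hl, pd_corW hv hw hb ξ hl, pd_corW hv hw hb ξ hl]
  ring

/-- constant of the corrugation lemma -/
def cC (X : ℝ) : ℝ := 18 * X * (6 * (4 * X) ^ 3)

lemma cC_ge {X : ℝ} (hX : 1 ≤ X) : 8 * (6 * (4 * X) ^ 3) ≤ cC X ∧ 4 * X ≤ cC X ∧ 1 ≤ cC X := by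
  have h3 : 1 ≤ X ^ 3 := one_le_pow₀ hX
  have : X ≤ X * X ^ 3 := le_mul_of_one_le_right (by linarith) h3
  unfold cC
  refine ⟨?_, ?_, ?_⟩ <;> nlinarith

lemma corr {v b : V2 → ℝ} {w : Fin 2 → V2 → ℝ} (hv : Sm v) (hw : ∀ j, Sm (w j))
    {ξ : V2} {X e μ G lam : ℝ} (hX : 1 ≤ X) (hξ : ∀ i, |ξ i| ≤ X) (hμ : 0 < μ) (hl : μ ≤ lam)
    (heG : e ≤ G) (hb : SB 3 e μ b) (hG : ∀ i, SB 2 G μ (pd i v))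
    (h2 : ∀ i j, SB 1 (e * μ) μ (pd i (pd j v))) :
    ∃ (v' : V2 → ℝ) (w' : Fin 2 → V2 → ℝ), Sm v' ∧ (∀ j, Sm (w' j)) ∧
      SB 3 (cC X * e / lam) lam (fun x => v' x - v x) ∧
      (∀ j, SB 2 (cC X * (e * G) / lam) lam (fun x => w' j x - w j x)) ∧
      (∀ i, SB 2 (G + cC X * e) lam (pd i v')) ∧
      (∀ i j, SB 1 ((1 + cC X) * e * lam) lam (pd i (pd j v'))) ∧
      (∀ i j x, |Df v' w' i j x - Df v w i j x - b x ^ 2 / 2 * (ξ i * ξ j)|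
        ≤ cC X * e ^ 2 * (μ / lam)) := by
  have hl0 : 0 < lam := hμ.trans_le hl
  have he : 0 ≤ e := hb.nonneg
  have hG0 : 0 ≤ G := he.trans heG
  obtain ⟨hc1, hc2, hc3⟩ := cC_ge hX
  have hK0 : 0 ≤ 6 * (4 * X) ^ 3 := by positivity
  have hs : SB 3 (6 * (4 * X) ^ 3) lam (fun x => Real.sin (lam * phase ξ x)) :=
    SB_sin _ (by linarith) hl0.le ((norm_phase ξ hξ).trans (by linarith))
  have hs2 : SB 3 (6 * (4 * X) ^ 3) lam (fun x => Real.sin (lam * ((2 : ℝ) • phase ξ) x)) :=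
    SB_sin _ (by linarith) hl0.le (by
      rw [norm_smul]; have := norm_phase ξ hξ; norm_num; linarith)
  have hbl : SB 3 e lam b := hb.mono le_rfl he hμ.le hl
  have hsv := sm_corV hv hb.1 ξ lam
  have hsw := sm_corW hv hw hb.1 ξ lam
  have hV : SB 3 (cC X * e / lam) lam (fun x => corV v b ξ lam x - v x) := by
    have h := (hbl.mul hl0.le hs).smul lam⁻¹
    have h' : SB 3 (cC X * e / lam) lam (fun x => lam⁻¹ * (b x * Real.sin (lam * phase ξ x))) := by
      refine h.mono ?_ (by positivity) hl0.le le_rfl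
      rw [abs_of_pos (inv_pos.2 hl0), div_eq_inv_mul]
      have := mul_le_mul_of_nonneg_right hc1 he
      exact mul_le_mul_of_nonneg_left (by linarith) (inv_pos.2 hl0).le
    convert h' using 2
    simp [corV]
  have hW : ∀ j, SB 2 (cC X * (e * G) / lam) lam (fun x => corW v w b ξ lam j x - w j x) := by
    intro j
    have hg : SB 2 G lam (pd j v) := (hG j).mono le_rfl hG0 hμ.le hl
    have hb2 := hbl.mono_n (show 2 ≤ 3 by norm_num)
    have t1 := (((hb2.mul hl0.le (hs.mono_n (show 2 ≤ 3 by norm_num))).mul hl0.le hg).smul (-lam⁻¹))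
    have t2 := (((hb2.mul hl0.le hb2).mul hl0.le (hs2.mono_n (show 2 ≤ 3 by norm_num))).smul
      (-(lam⁻¹ / 8 * ξ j)))
    have t := t1.add t2
    have t' : SB 2 (cC X * (e * G) / lam) lam (fun x =>
        (-lam⁻¹ * (b x * Real.sin (lam * phase ξ x) * pd j v x) +
    (-(lam⁻¹ / 8 * ξ j)) * (b x * b x * Real.sin (lam * ((2 : ℝ) • phase ξ) x)))) := by
      refine t.mono ?_ (by positivity) hl0.le le_rfl
      rw [abs_neg, abs_neg, abs_mul, abs_div, abs_of_pos (inv_pos.2 hl0), abs_of_pos (by norm_num : (0:ℝ) < 8)]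
      have hle : e * e ≤ e * G := mul_le_mul_of_nonneg_left heG he
      calc _ ≤ lam⁻¹ * (2 ^ 2 * (2 ^ 2 * (e * (6 * (4 * X) ^ 3)) * G)) +
            lam⁻¹ / 8 * X * (2 ^ 2 * (2 ^ 2 * (e * G) * (6 * (4 * X) ^ 3))) := by
              gcongr
              exact hξ j
        _ = lam⁻¹ * (e * G) * ((6 * (4 * X) ^ 3)) * (16 + 2 * X) := by ring
        _ ≤ lam⁻¹ * (e * G) * ((6 * (4 * X) ^ 3)) * (18 * X) := by gcongr; linarith
        _ = _ := by unfold cC; field_simp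
    convert t' using 2
    simp [corW]
  have hpv : ∀ i x, pd i (corV v b ξ lam) x =
      pd i v x + pd i (fun x => corV v b ξ lam x - v x) x := by
    intro i x
    rw [pd_sub (hsv.diff x) (hv.diff x)]; ring
  have hpV : ∀ i, SB 2 (cC X * e) lam (pd i (fun x => corV v b ξ lam x - v x)) := by
    intro i
    have := hV.pd i
    rwa [div_mul_cancel₀ _ hl0.ne'] at this
  refine ⟨corV v b ξ lam, corW v w b ξ lam, hsv, hsw, hV, hW, fun i => ?_, fun i j => ?_,
    fun i j x => ?_⟩
  · rw [show pd i (corV v b ξ lam) = _ from funext (hpv i)]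
    exact ((hG i).mono le_rfl hG0 hμ.le hl).add (hpV i)
  · have e1 : pd i (pd j (corV v b ξ lam)) = fun x => pd i (pd j v) x +
        pd i (pd j (fun x => corV v b ξ lam x - v x)) x := by
      rw [show pd j (corV v b ξ lam) = _ from funext (hpv j)]
      ext x
      exact pd_add ((hv.pd j).diff x) ((hpV j).1.diff x) i
    rw [e1]
    have := ((h2 i j).mono (c' := e * lam) (by gcongr) (by positivity) hμ.le hl).add ((hpV j).pd i)
    refine this.mono (le_of_eq (by ring)) (by positivity) hl0.le le_rfl
  · rw [Df_cor hv hw hb.1 ξ hl0.ne']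
    have hbx := hb.abs_le x
    have hbi : ∀ i, |pd i b x| ≤ e * μ := fun i => (hb.pd i).abs_le x
    have hvi : ∀ i j, |pd i (pd j v) x| ≤ e * μ := fun i j => (h2 i j).abs_le x
    set s := Real.sin (lam * phase ξ x)
    set c := Real.cos (lam * phase ξ x)
    have hs1 : |s| ≤ 1 := Real.abs_sin_le_one _
    have hc1 : |c| ≤ 1 := Real.abs_cos_le_one _
    have hli : |lam⁻¹| = lam⁻¹ := abs_of_pos (inv_pos.2 hl0)
    have T1 : |-(lam⁻¹ * b x * s * (pd i (pd j v) x + pd j (pd i v) x))|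
        ≤ lam⁻¹ * e * 1 * (e * μ + e * μ) := by
      rw [abs_neg, abs_mul, abs_mul, abs_mul, hli]
      gcongr
      exact (abs_add_le _ _).trans (add_le_add (hvi i j) (hvi j i))
    have T2 : |lam⁻¹ / 2 * b x * (s * c) * (pd i b x * ξ j + pd j b x * ξ i)|
        ≤ lam⁻¹ / 2 * e * (1 * 1) * (e * μ * X + e * μ * X) := by
      rw [abs_mul, abs_mul, abs_mul, abs_mul s, abs_div, hli, abs_of_pos (by norm_num : (0:ℝ) < 2)]
      gcongr
      refine (abs_add_le _ _).trans ?_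
      rw [abs_mul, abs_mul]
      gcongr
      · exact hbi i
      · exact hξ j
      · exact hbi j
      · exact hξ i
    have T3 : |(lam⁻¹ * lam⁻¹) * (pd i b x * pd j b x) * s ^ 2|
        ≤ (lam⁻¹ * lam⁻¹) * ((e * μ) * (e * μ)) * 1 ^ 2 := by
      rw [abs_mul, abs_mul, abs_mul, abs_mul (pd i b x), hli, abs_pow]
      gcongr
      · exact hbi i
      · exact hbi j
    have hr : lam⁻¹ * μ ≤ 1 := by
      rw [inv_mul_le_iff₀ hl0]; linarith
    have hr0 : 0 ≤ lam⁻¹ * μ := by positivity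
    have T4 : (lam⁻¹ * lam⁻¹) * ((e * μ) * (e * μ)) * 1 ^ 2 ≤ e ^ 2 * (lam⁻¹ * μ) := by
      calc _ = e ^ 2 * (lam⁻¹ * μ) * (lam⁻¹ * μ) := by ring
        _ ≤ e ^ 2 * (lam⁻¹ * μ) * 1 := by gcongr
        _ = _ := by ring
    calc _ ≤ _ := (abs_add_le _ _).trans (add_le_add_left (abs_add_le _ _) _)
      _ ≤ lam⁻¹ * e * 1 * (e * μ + e * μ) + lam⁻¹ / 2 * e * (1 * 1) * (e * μ * X + e * μ * X)
          + e ^ 2 * (lam⁻¹ * μ) := add_le_add (add_le_add T1 T2) (T3.trans T4)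
      _ = (3 + X) * (e ^ 2 * (lam⁻¹ * μ)) := by ring
      _ ≤ cC X * (e ^ 2 * (lam⁻¹ * μ)) := by gcongr; linarith
      _ = _ := by ring

lemma conv_bd (F : V2 → ℝ) (hF : Continuous F) (x : V2) (B : ℝ) (hB : 0 ≤ B) (j : ℕ) :
    ∀ {E' E'' : Type} [NormedAddCommGroup E'] [NormedSpace ℝ E'] [NormedAddCommGroup E'']
      [NormedSpace ℝ E''] [CompleteSpace E''] (L : E' →L[ℝ] ℝ →L[ℝ] E'') (φ : V2 → E'),
      ContDiff ℝ (⊤ : ℕ∞) φ → HasCompactSupport φ → (∀ y ∈ tsupport φ, |F (x - y)| ≤ B) →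
      ‖iteratedFDeriv ℝ j (MeasureTheory.convolution φ F L volume) x‖
        ≤ ‖L‖ * (∫ y, ‖iteratedFDeriv ℝ j φ y‖) * B := by
  induction j with
  | zero =>
    intro E' E'' _ _ _ _ _ L φ hφ hc hb
    rw [norm_iteratedFDeriv_zero]
    simp only [norm_iteratedFDeriv_zero]
    unfold MeasureTheory.convolution
    rw [mul_assoc, ← integral_mul_const, ← integral_const_mul]
    refine norm_integral_le_of_norm_le ?_ (Filter.Eventually.of_forall fun y => ?_)
    · have : Integrable (fun y => ‖φ y‖) :=
        (hφ.continuous.integrable_of_hasCompactSupport hc).norm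
      exact (this.mul_const B).const_mul ‖L‖
    · by_cases hy : y ∈ tsupport φ
      · calc _ ≤ ‖L‖ * ‖φ y‖ * ‖F (x - y)‖ := L.le_opNorm₂ _ _
          _ ≤ ‖L‖ * ‖φ y‖ * B := by gcongr; exact hb y hy
          _ = _ := by ring
      · rw [image_eq_zero_of_notMem_tsupport hy]; simp
  | succ j ih =>
    intro E' E'' _ _ _ _ _ L φ hφ hc hb
    rw [← norm_iteratedFDeriv_fderiv]
    have e : fderiv ℝ (MeasureTheory.convolution φ F L volume) =
        MeasureTheory.convolution (fderiv ℝ φ) F (L.precompL V2) volume := by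
      ext1 z
      exact (hc.hasFDerivAt_convolution_left L (hφ.of_le (natle 1))
        hF.locallyIntegrable z).fderiv
    rw [e]
    refine (ih (L.precompL V2) (fderiv ℝ φ) (ContDiff.fderiv_right hφ (by simp)) (hc.fderiv ℝ)
      (fun y hy => hb y (tsupport_fderiv_subset ℝ hy))).trans ?_
    simp only [norm_iteratedFDeriv_fderiv]
    have : 0 ≤ ∫ y, ‖iteratedFDeriv ℝ (j + 1) φ y‖ := integral_nonneg fun _ => norm_nonneg _
    gcongr
    exact ContinuousLinearMap.norm_precompL_le _ L

def bmp : ContDiffBump (0 : V2) := ⟨1 / 2, 1, by norm_num, by norm_num⟩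

/-- mollifying kernel -/
def ker : V2 → ℝ := bmp.normed volume

lemma ker_nonneg (y : V2) : 0 ≤ ker y := bmp.nonneg_normed y
lemma ker_int : ∫ y, ker y = 1 := bmp.integral_normed
lemma ker_sm : Sm ker := bmp.contDiff_normed
lemma ker_cpt : HasCompactSupport ker := bmp.hasCompactSupport_normed
lemma ker_tsupp {y : V2} (hy : y ∈ tsupport ker) : ‖y‖ ≤ 1 := by
  have : tsupport ker = Metric.closedBall 0 1 := bmp.tsupport_normed_eq
  rw [this] at hy
  simpa using hy
lemma ker_zero {y : V2} (hy : ¬ ‖y‖ ≤ 1) : ker y = 0 :=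
  image_eq_zero_of_notMem_tsupport (fun h => hy (ker_tsupp h))

/-- mollification at scale `l` -/
def moll (l : ℝ) (f : V2 → ℝ) (x : V2) : ℝ := ∫ y, ker y * f (x - l • y)

def Cm : ℝ := 1 + ∑ j ∈ Finset.range 4, ∫ y, ‖iteratedFDeriv ℝ j ker y‖

lemma Cm_ge : 1 ≤ Cm := by
  unfold Cm
  have : 0 ≤ ∑ j ∈ Finset.range 4, ∫ y, ‖iteratedFDeriv ℝ j ker y‖ :=
    Finset.sum_nonneg fun j _ => integral_nonneg fun _ => norm_nonneg _
  linarith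

lemma Cm_ge' {j : ℕ} (hj : j ≤ 3) : ∫ y, ‖iteratedFDeriv ℝ j ker y‖ ≤ Cm := by
  unfold Cm
  have := Finset.single_le_sum (f := fun j => ∫ y, ‖iteratedFDeriv ℝ j ker y‖)
    (fun j _ => integral_nonneg fun _ => norm_nonneg _)
    (Finset.mem_range.2 (Nat.lt_succ_of_le hj) : j ∈ Finset.range 4)
  linarith

lemma moll_integrable (l : ℝ) {f : V2 → ℝ} (hf : Continuous f) (x : V2) :
    Integrable (fun y => ker y * f (x - l • y)) := by
  apply Continuous.integrable_of_hasCompactSupport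
  · have := ker_sm.cont; fun_prop
  · exact ker_cpt.mul_right

lemma moll_eq {l : ℝ} (hl : 0 < l) (f : V2 → ℝ) : moll l f = fun x =>
    MeasureTheory.convolution ker (fun z => f (l • z)) (ContinuousLinearMap.mul ℝ ℝ) volume
      (l⁻¹ • x) := by
  ext x
  simp only [moll, MeasureTheory.convolution, ContinuousLinearMap.mul_apply', smul_sub,
    smul_inv_smul₀ hl.ne']

lemma conv_sm {F : V2 → ℝ} (hF : Continuous F) :
    ContDiff ℝ (⊤ : ℕ∞) (MeasureTheory.convolution ker F (ContinuousLinearMap.mul ℝ ℝ) volume) :=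
  ker_cpt.contDiff_convolution_left _ ker_sm hF.locallyIntegrable

lemma moll_sm {l : ℝ} (hl : 0 < l) {f : V2 → ℝ} (hf : Continuous f) : Sm (moll l f) := by
  rw [moll_eq hl]
  exact (conv_sm (by fun_prop)).comp (contDiff_const_smul _)

lemma moll_bd {l : ℝ} (hl : 0 < l) {f : V2 → ℝ} (hf : Continuous f) {x : V2} {B : ℝ}
    (hB : ∀ z, ‖z - x‖ ≤ l → |f z| ≤ B) {j : ℕ} (hj : j ≤ 3) :
    ‖iteratedFDeriv ℝ j (moll l f) x‖ ≤ Cm * B * l⁻¹ ^ j := by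
  have hB0 : 0 ≤ B := (abs_nonneg _).trans (hB x (by simpa using hl.le))
  have hc : Continuous (fun z => f (l • z)) := by fun_prop
  rw [moll_eq hl, iteratedFDeriv_comp_const_smul l⁻¹ ((conv_sm hc).of_le (natle j)), norm_smul,
    norm_pow, norm_inv, Real.norm_eq_abs, abs_of_pos hl, mul_comm]
  gcongr
  refine (conv_bd _ hc _ B hB0 j _ ker ker_sm ker_cpt fun y hy => ?_).trans ?_
  · apply hB
    rw [smul_sub, smul_inv_smul₀ hl.ne']
    have := ker_tsupp hy
    simp only [sub_sub_cancel_left, norm_neg, norm_smul, Real.norm_eq_abs, abs_of_pos hl]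
    nlinarith
  · gcongr
    calc _ ≤ 1 * Cm := by
            exact mul_le_mul (ContinuousLinearMap.opNorm_mul_le _ _) (Cm_ge' hj)
              (integral_nonneg fun _ => norm_nonneg _) zero_le_one
      _ = Cm := one_mul _

lemma moll_abs {l : ℝ} (hl : 0 < l) {f : V2 → ℝ} (hf : Continuous f) {x : V2} {B : ℝ}
    (hB : ∀ z, ‖z - x‖ ≤ l → |f z| ≤ B) : |moll l f x| ≤ B := by
  have := norm_integral_le_of_norm_le (f := fun y => ker y * f (x - l • y))
    (g := fun y => ker y * B) (μ := volume)
    ((ker_sm.cont.integrable_of_hasCompactSupport ker_cpt).mul_const B)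
    (Filter.Eventually.of_forall fun y => by
      by_cases hy : ‖y‖ ≤ 1
      · rw [norm_mul, Real.norm_eq_abs, abs_of_nonneg (ker_nonneg y)]
        refine mul_le_mul_of_nonneg_left (hB _ ?_) (ker_nonneg y)
        simp only [sub_sub_cancel_left, norm_neg, norm_smul, Real.norm_eq_abs, abs_of_pos hl]
        nlinarith
      · rw [ker_zero hy]; simp)
  rw [integral_mul_const, ker_int, one_mul] at this
  exact this

lemma moll_const (l c : ℝ) (x : V2) : moll l (fun _ => c) x = c := by
  unfold moll; rw [integral_mul_const, ker_int, one_mul]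

lemma moll_add (l : ℝ) {f g : V2 → ℝ} (hf : Continuous f) (hg : Continuous g) (x : V2) :
    moll l (fun y => f y + g y) x = moll l f x + moll l g x := by
  unfold moll
  rw [← integral_add (moll_integrable l hf x) (moll_integrable l hg x)]
  simp only [mul_add]

lemma moll_sub (l : ℝ) {f g : V2 → ℝ} (hf : Continuous f) (hg : Continuous g) (x : V2) :
    moll l (fun y => f y - g y) x = moll l f x - moll l g x := by
  unfold moll
  rw [← integral_sub (moll_integrable l hf x) (moll_integrable l hg x)]
  simp only [mul_sub]

lemma moll_const_mul (l k : ℝ) (f : V2 → ℝ) (x : V2) :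
    moll l (fun y => k * f y) x = k * moll l f x := by
  unfold moll
  rw [← integral_const_mul]
  congr 1; ext y; ring

lemma moll_close {l : ℝ} (hl : 0 < l) {f : V2 → ℝ} (hf : Continuous f) {x : V2} {B : ℝ}
    (hB : ∀ z, ‖z - x‖ ≤ l → |f z - f x| ≤ B) : |moll l f x - f x| ≤ B := by
  have := moll_abs hl (f := fun y => f y - f x) (by fun_prop) hB
  rwa [moll_sub l hf continuous_const, moll_const] at this

lemma moll_pd (l : ℝ) {f : V2 → ℝ} (hf : ContDiff ℝ 1 f) (i : Fin 2) (x : V2) :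
    pd i (moll l f) x = moll l (pd i f) x := by
  have hd : Continuous (fderiv ℝ f) := hf.continuous_fderiv (by norm_num)
  have hk := ker_sm.cont
  obtain ⟨B, hB⟩ := (isCompact_closedBall x (1 + |l|)).exists_bound_of_continuousOn hd.continuousOn
  have key := hasFDerivAt_integral_of_dominated_of_fderiv_le (𝕜 := ℝ) (μ := (volume : Measure V2))
    (F := fun x y => ker y * f (x - l • y)) (F' := fun x y => ker y • fderiv ℝ f (x - l • y))
    (x₀ := x) (s := Metric.ball x 1) (bound := fun y => ker y * B)
    (Metric.ball_mem_nhds x one_pos)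
    (Filter.Eventually.of_forall fun z => (moll_integrable l hf.continuous z).aestronglyMeasurable)
    (moll_integrable l hf.continuous x)
    (by
      have : Continuous (fun y => ker y • fderiv ℝ f (x - l • y)) := by fun_prop
      exact this.aestronglyMeasurable)
    (Filter.Eventually.of_forall fun y z hz => by
      by_cases hy : ‖y‖ ≤ 1
      · rw [norm_smul, Real.norm_eq_abs, abs_of_nonneg (ker_nonneg y)]
        refine mul_le_mul_of_nonneg_left (hB _ ?_) (ker_nonneg y)
        rw [mem_closedBall_iff_norm]
        have h1 : ‖z - x‖ < 1 := by simpa [dist_eq_norm] using hz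
        have h2 : ‖l • y‖ ≤ |l| := by
          rw [norm_smul, Real.norm_eq_abs]; nlinarith [abs_nonneg l]
        calc ‖z - l • y - x‖ = ‖(z - x) - l • y‖ := by congr 1; abel
          _ ≤ ‖z - x‖ + ‖l • y‖ := norm_sub_le _ _
          _ ≤ _ := by linarith
      · rw [ker_zero hy]; simp)
    ((hk.integrable_of_hasCompactSupport ker_cpt).mul_const B)
    (Filter.Eventually.of_forall fun y z _ => by
      have h1 : HasFDerivAt f (fderiv ℝ f (z - l • y)) (z - l • y) :=
        (hf.differentiable (by norm_num) _).hasFDerivAt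
      have h2 : HasFDerivAt (fun z => f (z - l • y)) (fderiv ℝ f (z - l • y)) z := by
        exact (hasFDerivAt_comp_sub (l • y)).2 h1
      exact h2.const_mul (ker y))
  have e : HasFDerivAt (moll l f) _ x := key
  simp only [pd]
  rw [e.fderiv, ContinuousLinearMap.integral_apply]
  · rfl
  · apply Continuous.integrable_of_hasCompactSupport
    · fun_prop
    · exact ker_cpt.smul_right

lemma corr' {X : ℝ} (hX : 1 ≤ X) {v b : V2 → ℝ} {w : Fin 2 → V2 → ℝ} (hv : Sm v) (hw : ∀ j, Sm (w j))
    {ξ : V2} {e μ G lam : ℝ} (hξ : ∀ i, |ξ i| ≤ X) (hμ : 0 < μ) (hl : μ ≤ lam)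
    (heG : e ≤ G) (hb : SB 3 e μ b) (hG : ∀ i, SB 2 G μ (pd i v))
    (h2 : ∀ i j, SB 1 (e * μ) μ (pd i (pd j v))) :
    ∃ (v' : V2 → ℝ) (w' : Fin 2 → V2 → ℝ), Sm v' ∧ (∀ j, Sm (w' j)) ∧
      (∀ i, SB 2 ((1 + cC X) * G) lam (pd i v')) ∧
      (∀ i j, SB 1 ((1 + cC X) * e * lam) lam (pd i (pd j v'))) ∧
      (∀ x, |v' x - v x| ≤ (1 + cC X) * e / lam) ∧
      (∀ j x, |w' j x - w j x| ≤ (1 + cC X) * (e * G) / lam) ∧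
      (∀ i x, |pd i v' x - pd i v x| ≤ (1 + cC X) * e) ∧
      (∀ i j x, |pd i (w' j) x - pd i (w j) x| ≤ (1 + cC X) * (e * G)) ∧
      (∀ i j x y, |(pd i (w' j) x - pd i (w j) x) - (pd i (w' j) y - pd i (w j) y)|
        ≤ (1 + cC X) * (e * G) * lam * ‖x - y‖) ∧
      (∀ i j x, |Df v' w' i j x - Df v w i j x - b x ^ 2 / 2 * (ξ i * ξ j)|
        ≤ (1 + cC X) * e ^ 2 * (μ / lam)) := by
  obtain ⟨v', w', hv', hw', a1, a2, a3, a4, a5⟩ := corr hv hw hX hξ hμ hl heG hb hG h2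
  have hl0 : 0 < lam := hμ.trans_le hl
  have he : 0 ≤ e := hb.nonneg
  have hG0 : 0 ≤ G := he.trans heG
  obtain ⟨-, -, hc⟩ := cC_ge hX
  have hc0 : 0 ≤ cC X := by linarith
  have hcc : cC X ≤ 1 + cC X := by linarith
  have pv : ∀ i x, pd i (fun x => v' x - v x) x = pd i v' x - pd i v x := fun i x =>
    pd_sub (hv'.diff x) (hv.diff x) i
  have pw : ∀ i j x, pd i (fun x => w' j x - w j x) x = pd i (w' j) x - pd i (w j) x := fun i j x =>
    pd_sub ((hw' j).diff x) ((hw j).diff x) i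
  refine ⟨v', w', hv', hw', fun i => (a3 i).mono ?_ (by positivity) hl0.le le_rfl, a4,
    fun x => (a1.abs_le x).trans (by gcongr), fun j x => ((a2 j).abs_le x).trans (by gcongr),
    fun i x => ?_, fun i j x => ?_, fun i j x y => ?_, fun i j x => (a5 i j x).trans (by gcongr)⟩
  · nlinarith
  · have := (a1.pd i).abs_le x
    rw [pv, div_mul_cancel₀ _ hl0.ne'] at this
    exact this.trans (by gcongr)
  · have := ((a2 j).pd i).abs_le x
    rw [pw, div_mul_cancel₀ _ hl0.ne'] at this
    exact this.trans (by gcongr)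
  · have := ((a2 j).pd i).lip x y
    rw [pw, pw, div_mul_cancel₀ _ hl0.ne'] at this
    exact this.trans (by gcongr)

/-- Three corrugations. -/
lemma corr3 : ∃ K : ℝ, 1 ≤ K ∧ ∀ {v : V2 → ℝ} {b : Fin 3 → V2 → ℝ} {w : Fin 2 → V2 → ℝ}
    (_ : Sm v) (_ : ∀ j, Sm (w j))
    {ξ : Fin 3 → V2} {e μ G σ : ℝ} (_ : ∀ k i, |ξ k i| ≤ 1) (_ : 0 < μ) (_ : 1 ≤ σ)
    (_ : e ≤ G) (_ : ∀ k, SB 3 e μ (b k)) (_ : ∀ i, SB 2 G μ (pd i v))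
    (_ : ∀ i j, SB 1 (e * μ) μ (pd i (pd j v))),
    ∃ (v' : V2 → ℝ) (w' : Fin 2 → V2 → ℝ), Sm v' ∧ (∀ j, Sm (w' j)) ∧
      (∀ i x y, |pd i v' x - pd i v' y| ≤ K * e * (μ * σ ^ 3) * ‖x - y‖) ∧
      (∀ x, |v' x - v x| ≤ K * e / μ) ∧
      (∀ j x, |w' j x - w j x| ≤ K * (e * G) / μ) ∧
      (∀ i x, |pd i v' x - pd i v x| ≤ K * e) ∧
      (∀ i j x, |pd i (w' j) x - pd i (w j) x| ≤ K * (e * G)) ∧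
      (∀ i j x y, |(pd i (w' j) x - pd i (w j) x) - (pd i (w' j) y - pd i (w j) y)|
        ≤ K * (e * G) * (μ * σ ^ 3) * ‖x - y‖) ∧
      (∀ i j x, |Df v' w' i j x - Df v w i j x - ∑ k, b k x ^ 2 / 2 * (ξ k i * ξ k j)|
        ≤ K * e ^ 2 / σ) := by
  obtain ⟨-, -, hc⟩ := cC_ge (le_refl (1:ℝ))
  set k : ℝ := 1 + cC 1 with hk
  have hk1 : 1 ≤ k := by linarith
  refine ⟨6 * k ^ 6, by nlinarith [one_le_pow₀ hk1 (n := 6)], ?_⟩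
  intro v b w hv hw ξ e μ G σ hξ hμ hσ heG hb hG h2
  have he : 0 ≤ e := (hb 0).nonneg
  have hG0 : 0 ≤ G := he.trans heG
  have hk0 : 0 ≤ k := by linarith
  have hσ0 : 0 < σ := by linarith
  have l1 : μ ≤ μ * σ := by nlinarith
  have l2 : μ * σ ≤ μ * σ ^ 2 := by rw [pow_two, ← mul_assoc]; exact le_mul_of_one_le_right (by positivity) hσ
  have l3 : μ * σ ^ 2 ≤ μ * σ ^ 3 := by rw [pow_succ σ 2, ← mul_assoc]; exact le_mul_of_one_le_right (by positivity) hσ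
  obtain ⟨v1, w1, hv1, hw1, a1, a2, a3, a4, a5, a6, a7, a8⟩ :=
    corr' le_rfl hv hw (hξ 0) hμ l1 heG (hb 0) hG h2
  rw [← hk] at a1 a2 a3 a4 a5 a6 a7 a8
  have e1 : e ≤ k * e := by nlinarith
  have e2 : k * e ≤ k * (k * e) := by nlinarith [mul_nonneg hk0 he]
  obtain ⟨v2, w2, hv2, hw2, b1, b2, b3, b4, b5, b6, b7, b8⟩ :=
    corr' le_rfl hv1 hw1 (hξ 1) (hμ.trans_le l1) l2 (by gcongr)
      ((hb 1).mono e1 (by positivity) hμ.le l1) a1 a2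
  rw [← hk] at b1 b2 b3 b4 b5 b6 b7 b8
  obtain ⟨v3, w3, hv3, hw3, c1, c2, c3, c4, c5, c6, c7, c8⟩ :=
    corr' le_rfl hv2 hw2 (hξ 2) (hμ.trans_le (l1.trans l2)) l3 (by gcongr)
      ((hb 2).mono (e1.trans e2) (by positivity) hμ.le (l1.trans l2)) b1 b2
  rw [← hk] at c1 c2 c3 c4 c5 c6 c7 c8
  have p : ∀ n m : ℕ, n ≤ m → k ^ n ≤ k ^ m := fun n m h => pow_le_pow_right₀ hk1 h
  have hd : ∀ a : ℝ, 0 ≤ a → ∀ M, μ ≤ M → a / M ≤ a / μ := fun a ha M hM => by gcongr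
  refine ⟨v3, w3, hv3, hw3, fun i x y => ?_, fun x => ?_, fun j x => ?_, fun i x => ?_,
    fun i j x => ?_, fun i j x y => ?_, fun i j x => ?_⟩
  · refine (lip_of_pd (hv3.pd i).diff (fun j z => (c2 j i).abs_le z) x y).trans ?_
    refine mul_le_mul_of_nonneg_right ?_ (norm_nonneg _)
    have : k ^ 3 * (e * (μ * σ ^ 3)) ≤ k ^ 6 * (e * (μ * σ ^ 3)) := by gcongr 1; exact p 3 6 (by norm_num)
    have h0 : 0 ≤ k ^ 6 * (e * (μ * σ ^ 3)) := by positivity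
    nlinarith
  · have h1 := (a3 x).trans (hd _ (by positivity) _ l1)
    have h2 := (b3 x).trans (hd _ (by positivity) _ (l1.trans l2))
    have h3 := (c3 x).trans (hd _ (by positivity) _ (l1.trans (l2.trans l3)))
    have t : |v3 x - v x| ≤ |v1 x - v x| + |v2 x - v1 x| + |v3 x - v2 x| := by
      have : v3 x - v x = (v1 x - v x) + (v2 x - v1 x) + (v3 x - v2 x) := by ring
      rw [this]; exact abs_add_three _ _ _
    have q0 : 0 ≤ e / μ := by positivity
    have : k * e / μ + k * (k * e) / μ + k * (k * (k * e)) / μ ≤ 6 * k ^ 6 * e / μ := by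
      have : k * e / μ + k * (k * e) / μ + k * (k * (k * e)) / μ = (k ^ 1 + k ^ 2 + k ^ 3) * (e / μ) := by ring
      rw [this, show 6 * k ^ 6 * e / μ = (6 * k ^ 6) * (e / μ) by ring]
      gcongr
      linarith [p 1 6 (by norm_num), p 2 6 (by norm_num), p 3 6 (by norm_num), pow_nonneg hk0 6]
    linarith
  · have h1 := (a4 j x).trans (hd _ (by positivity) _ l1)
    have h2 := (b4 j x).trans (hd _ (by positivity) _ (l1.trans l2))
    have h3 := (c4 j x).trans (hd _ (by positivity) _ (l1.trans (l2.trans l3)))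
    have t : |w3 j x - w j x| ≤ |w1 j x - w j x| + |w2 j x - w1 j x| + |w3 j x - w2 j x| := by
      have : w3 j x - w j x = (w1 j x - w j x) + (w2 j x - w1 j x) + (w3 j x - w2 j x) := by ring
      rw [this]; exact abs_add_three _ _ _
    have q0 : 0 ≤ (e * G) / μ := by positivity
    have : k * (e * G) / μ + k * (k * e * (k * G)) / μ + k * (k * (k * e) * (k * (k * G))) / μ
        ≤ 6 * k ^ 6 * (e * G) / μ := by
      have : k * (e * G) / μ + k * (k * e * (k * G)) / μ + k * (k * (k * e) * (k * (k * G))) / μ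
        = (k ^ 1 + k ^ 3 + k ^ 5) * (e * G / μ) := by ring
      rw [this, show 6 * k ^ 6 * (e * G) / μ = (6 * k ^ 6) * (e * G / μ) by ring]
      gcongr
      linarith [p 1 6 (by norm_num), p 3 6 (by norm_num), p 5 6 (by norm_num), pow_nonneg hk0 6]
    linarith
  · have h1 := a5 i x
    have h2 := b5 i x
    have h3 := c5 i x
    have t : |pd i v3 x - pd i v x| ≤ |pd i v1 x - pd i v x| + |pd i v2 x - pd i v1 x| + |pd i v3 x - pd i v2 x| := by
      have : pd i v3 x - pd i v x = (pd i v1 x - pd i v x) + (pd i v2 x - pd i v1 x) + (pd i v3 x - pd i v2 x) := by ring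
      rw [this]; exact abs_add_three _ _ _
    have : k * e + k * (k * e) + k * (k * (k * e)) ≤ 6 * k ^ 6 * e := by
      have : k * e + k * (k * e) + k * (k * (k * e)) = (k ^ 1 + k ^ 2 + k ^ 3) * e := by ring
      rw [this]
      gcongr
      linarith [p 1 6 (by norm_num), p 2 6 (by norm_num), p 3 6 (by norm_num), pow_nonneg hk0 6]
    linarith
  · have h1 := a6 i j x
    have h2 := b6 i j x
    have h3 := c6 i j x
    have t : |pd i (w3 j) x - pd i (w j) x| ≤ |pd i (w1 j) x - pd i (w j) x| + |pd i (w2 j) x - pd i (w1 j) x| + |pd i (w3 j) x - pd i (w2 j) x| := by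
      have : pd i (w3 j) x - pd i (w j) x = (pd i (w1 j) x - pd i (w j) x) + (pd i (w2 j) x - pd i (w1 j) x) + (pd i (w3 j) x - pd i (w2 j) x) := by ring
      rw [this]; exact abs_add_three _ _ _
    have : k * (e * G) + k * (k * e * (k * G)) + k * (k * (k * e) * (k * (k * G)))
        ≤ 6 * k ^ 6 * (e * G) := by
      have : k * (e * G) + k * (k * e * (k * G)) + k * (k * (k * e) * (k * (k * G)))
        = (k ^ 1 + k ^ 3 + k ^ 5) * (e * G) := by ring
      rw [this]
      gcongr
      linarith [p 1 6 (by norm_num), p 3 6 (by norm_num), p 5 6 (by norm_num), pow_nonneg hk0 6]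
    linarith
  · have h1 := a7 i j x y
    have h2 := b7 i j x y
    have h3 := c7 i j x y
    have t : |(pd i (w3 j) x - pd i (w j) x) - (pd i (w3 j) y - pd i (w j) y)| ≤
        |(pd i (w1 j) x - pd i (w j) x) - (pd i (w1 j) y - pd i (w j) y)| +
        |(pd i (w2 j) x - pd i (w1 j) x) - (pd i (w2 j) y - pd i (w1 j) y)| +
        |(pd i (w3 j) x - pd i (w2 j) x) - (pd i (w3 j) y - pd i (w2 j) y)| := by
      refine le_trans (le_of_eq ?_) (abs_add_three _ _ _)
      congr 1; ring
    have : k * (e * G) * (μ * σ) * ‖x - y‖ + k * (k * e * (k * G)) * (μ * σ ^ 2) * ‖x - y‖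
        + k * (k * (k * e) * (k * (k * G))) * (μ * σ ^ 3) * ‖x - y‖
        ≤ 6 * k ^ 6 * (e * G) * (μ * σ ^ 3) * ‖x - y‖ := by
      have : k * (e * G) * (μ * σ) * ‖x - y‖ + k * (k * e * (k * G)) * (μ * σ ^ 2) * ‖x - y‖
        + k * (k * (k * e) * (k * (k * G))) * (μ * σ ^ 3) * ‖x - y‖
        ≤ k * (e * G) * (μ * σ ^ 3) * ‖x - y‖ + k * (k * e * (k * G)) * (μ * σ ^ 3) * ‖x - y‖
        + k * (k * (k * e) * (k * (k * G))) * (μ * σ ^ 3) * ‖x - y‖ := by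
          have := l2.trans l3
          gcongr
      refine this.trans ?_
      have : k * (e * G) * (μ * σ ^ 3) * ‖x - y‖ + k * (k * e * (k * G)) * (μ * σ ^ 3) * ‖x - y‖
        + k * (k * (k * e) * (k * (k * G))) * (μ * σ ^ 3) * ‖x - y‖
        = (k ^ 1 + k ^ 3 + k ^ 5) * (e * G) * (μ * σ ^ 3) * ‖x - y‖ := by ring
      rw [this]
      gcongr
      linarith [p 1 6 (by norm_num), p 3 6 (by norm_num), p 5 6 (by norm_num), pow_nonneg hk0 6]
    linarith
  · have h1 := a8 i j x
    have h2 := b8 i j x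
    have h3 := c8 i j x
    have r1 : μ / (μ * σ) = 1 / σ := by field_simp
    have r2 : μ * σ / (μ * σ ^ 2) = 1 / σ := by field_simp
    have r3 : μ * σ ^ 2 / (μ * σ ^ 3) = 1 / σ := by field_simp
    rw [r1] at h1; rw [r2] at h2; rw [r3] at h3
    rw [Fin.sum_univ_three]
    have t : |Df v3 w3 i j x - Df v w i j x - (b 0 x ^ 2 / 2 * (ξ 0 i * ξ 0 j) + b 1 x ^ 2 / 2 * (ξ 1 i * ξ 1 j) + b 2 x ^ 2 / 2 * (ξ 2 i * ξ 2 j))| ≤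
        |Df v1 w1 i j x - Df v w i j x - b 0 x ^ 2 / 2 * (ξ 0 i * ξ 0 j)| +
        |Df v2 w2 i j x - Df v1 w1 i j x - b 1 x ^ 2 / 2 * (ξ 1 i * ξ 1 j)| +
        |Df v3 w3 i j x - Df v2 w2 i j x - b 2 x ^ 2 / 2 * (ξ 2 i * ξ 2 j)| := by
      refine le_trans (le_of_eq ?_) (abs_add_three _ _ _)
      congr 1; ring
    have : k * e ^ 2 * (1 / σ) + k * (k * e) ^ 2 * (1 / σ) + k * (k * (k * e)) ^ 2 * (1 / σ)
        ≤ 6 * k ^ 6 * e ^ 2 / σ := by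
      have : k * e ^ 2 * (1 / σ) + k * (k * e) ^ 2 * (1 / σ) + k * (k * (k * e)) ^ 2 * (1 / σ)
        = (k ^ 1 + k ^ 3 + k ^ 5) * e ^ 2 / σ := by ring
      rw [this]
      gcongr
      linarith [p 1 6 (by norm_num), p 3 6 (by norm_num), p 5 6 (by norm_num), pow_nonneg hk0 6]
    linarith

lemma pd_bd_pt {f : V2 → ℝ} (hf : Sm f) (i : Fin 2) (j : ℕ) (x : V2) :
    ‖iteratedFDeriv ℝ j (pd i f) x‖ ≤ ‖iteratedFDeriv ℝ (j + 1) f x‖ := by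
  have h1 : ContDiff ℝ (⊤ : ℕ∞) (fderiv ℝ f) := ContDiff.fderiv_right hf (by simp)
  have := norm_iteratedFDeriv_clm_apply_const (𝕜 := ℝ) (f := fderiv ℝ f)
    (c := (Pi.single i 1 : V2)) (x := x) (n := j) (N := ((⊤ : ℕ∞) : WithTop ℕ∞))
    h1.contDiffAt (natle j)
  rwa [norm_single, one_mul, norm_iteratedFDeriv_fderiv] at this

lemma sqrt_SB (m K : ℝ) (hm : 0 < m) : ∃ C : ℝ, 0 ≤ C ∧ ∀ (μ : ℝ) (g : V2 → ℝ), 0 ≤ μ →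
    SB 3 K μ g → (∀ x, m ≤ g x) → SB 3 C μ (fun x => Real.sqrt (g x)) := by
  have hs : ContDiffOn ℝ (⊤ : ℕ∞) Real.sqrt (Set.Ioi 0) := fun x hx =>
    (Real.contDiffAt_sqrt (ne_of_gt hx)).contDiffWithinAt
  have hc : ∀ i : ℕ, ∃ B : ℝ, ∀ t ∈ Set.Icc m K, ‖iteratedFDerivWithin ℝ i Real.sqrt (Set.Ioi 0) t‖ ≤ B := by
    intro i
    have h1 : ContinuousOn (iteratedFDerivWithin ℝ i Real.sqrt (Set.Ioi 0)) (Set.Ioi 0) :=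
      hs.continuousOn_iteratedFDerivWithin (natle i) (uniqueDiffOn_Ioi 0)
    exact isCompact_Icc.exists_bound_of_continuousOn
      (h1.mono fun t ht => lt_of_lt_of_le hm ht.1)
  choose B hB using hc
  set B' : ℝ := |B 0| + |B 1| + |B 2| + |B 3| with hB'
  have hB'0 : 0 ≤ B' := by positivity
  have hBB : ∀ i ≤ 3, B i ≤ B' := by
    intro i hi
    have := le_abs_self (B i)
    interval_cases i <;> linarith [abs_nonneg (B 0), abs_nonneg (B 1), abs_nonneg (B 2), abs_nonneg (B 3)]
  set D : ℝ := max K 1 with hD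
  have hD1 : 1 ≤ D := le_max_right _ _
  refine ⟨6 * B' * D ^ 3, by positivity, fun μ g hμ hg hmg => ⟨?_, fun j hj x => ?_⟩⟩
  · have : Sm (fun x => Real.sqrt (g x)) := by
      unfold Sm
      rw [contDiff_iff_contDiffAt]
      intro x
      exact (Real.contDiffAt_sqrt (lt_of_lt_of_le hm (hmg x)).ne').comp x (ContDiff.contDiffAt hg.1)
    exact this
  · have hgr : g x ∈ Set.Icc m K := ⟨hmg x, (le_abs_self _).trans (hg.abs_le x)⟩
    have := norm_iteratedFDeriv_comp_le' (𝕜 := ℝ) (g := Real.sqrt) (f := g) (n := j)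
      (N := ((⊤ : ℕ∞) : WithTop ℕ∞)) (t := Set.Ioi 0)
      (by rintro _ ⟨y, rfl⟩; exact lt_of_lt_of_le hm (hmg y)) (uniqueDiffOn_Ioi 0) hs hg.1 (natle j) x
      (C := B') (D := D * μ) (fun i hi => (hB i _ hgr).trans (hBB i (hi.trans hj)))
      (fun i h1 hi => (hg.2 i (hi.trans hj) x).trans (by
        rw [mul_pow]; gcongr
        exact (le_max_left _ _).trans (le_self_pow₀ hD1 (by omega))))
    refine le_trans (le_of_eq rfl) (this.trans ?_)
    rw [mul_pow]
    have h1 : (j.factorial : ℝ) ≤ 6 := by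
      have : j.factorial ≤ Nat.factorial 3 := Nat.factorial_le hj
      exact_mod_cast this
    have h2 : D ^ j ≤ D ^ 3 := pow_le_pow_right₀ hD1 hj
    calc _ = (j.factorial : ℝ) * B' * D ^ j * μ ^ j := by ring
      _ ≤ _ := by gcongr

lemma comm_bd {l : ℝ} (hl : 0 < l) {f g : V2 → ℝ} (hf : Continuous f) (hg : Continuous g)
    {a b : ℝ} (hfa : ∀ x z, ‖z - x‖ ≤ l → |f z - f x| ≤ a) (hgb : ∀ x z, ‖z - x‖ ≤ l → |g z - g x| ≤ b) :
    SB 3 (9 * Cm ^ 2 * (a * b)) l⁻¹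
      (fun x => moll l (fun y => f y * g y) x - moll l f x * moll l g x) := by
  have hli : 0 < l⁻¹ := by positivity
  have hCm := Cm_ge
  refine ⟨(moll_sm hl (by fun_prop)).sub ((moll_sm hl hf).mul (moll_sm hl hg)), fun j hj x => ?_⟩
  have ha : 0 ≤ a := (abs_nonneg _).trans (hfa x x (by simpa using hl.le))
  have hb : 0 ≤ b := (abs_nonneg _).trans (hgb x x (by simpa using hl.le))
  set F : V2 → ℝ := fun y => f y - f x
  set G : V2 → ℝ := fun y => g y - g x
  have hF : Continuous F := by fun_prop
  have hG : Continuous G := by fun_prop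
  have e : (fun x => moll l (fun y => f y * g y) x - moll l f x * moll l g x) =
      (fun x => moll l (fun y => F y * G y) x - moll l F x * moll l G x) := by
    ext z
    have e1 : moll l F z = moll l f z - f x := by
      rw [moll_sub l hf continuous_const, moll_const]
    have e2 : moll l G z = moll l g z - g x := by
      rw [moll_sub l hg continuous_const, moll_const]
    have e3 : moll l (fun y => F y * G y) z =
        moll l (fun y => f y * g y) z - (g x * moll l f z + (f x * moll l g z - f x * g x)) := by
      have : (fun y => F y * G y) = fun y => f y * g y - (g x * f y + (f x * g y - f x * g x)) := by
        ext y; simp only [F, G]; ring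
      rw [this, moll_sub l (by fun_prop) (by fun_prop), moll_add l (by fun_prop) (by fun_prop),
        moll_sub l (by fun_prop) (by fun_prop), moll_const_mul, moll_const_mul, moll_const]
    rw [e1, e2, e3]; ring
  rw [e]
  have s1 : Sm (moll l (fun y => F y * G y)) := moll_sm hl (by fun_prop)
  have s2 : Sm (fun x => moll l F x * moll l G x) := (moll_sm hl hF).mul (moll_sm hl hG)
  have e4 : iteratedFDeriv ℝ j (fun x => moll l (fun y => F y * G y) x - moll l F x * moll l G x) x =
      iteratedFDeriv ℝ j (moll l (fun y => F y * G y)) x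
       - iteratedFDeriv ℝ j (fun x => moll l F x * moll l G x) x :=
    iteratedFDeriv_sub_apply ((ContDiff.of_le s1 (natle j)).contDiffAt) ((ContDiff.of_le s2 (natle j)).contDiffAt)
  rw [e4]
  have b1 : ‖iteratedFDeriv ℝ j (moll l (fun y => F y * G y)) x‖ ≤ Cm * (a * b) * l⁻¹ ^ j := by
    refine moll_bd hl (by fun_prop) (fun z hz => ?_) hj
    rw [abs_mul]
    exact mul_le_mul (hfa x z hz) (hgb x z hz) (abs_nonneg _) ha
  have b2 := leib (moll_sm hl hF) (moll_sm hl hG) x j hli.le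
    (fun i hi => moll_bd hl hF (fun z hz => hfa x z hz) (hi.trans hj))
    (fun i hi => moll_bd hl hG (fun z hz => hgb x z hz) (hi.trans hj))
  refine (norm_sub_le _ _).trans ((add_le_add b1 b2).trans ?_)
  have h2 : (2:ℝ) ^ j ≤ 8 := by
    calc (2:ℝ)^j ≤ 2 ^ 3 := pow_le_pow_right₀ (by norm_num) hj
      _ = 8 := by norm_num
  have h3 : Cm ≤ Cm ^ 2 := by nlinarith
  have h4 : 0 ≤ a * b := by positivity
  calc _ = (Cm * (a * b) + 2 ^ j * (Cm * a * (Cm * b))) * l⁻¹ ^ j := by ring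
    _ ≤ (Cm ^ 2 * (a * b) + 8 * (Cm * a * (Cm * b))) * l⁻¹ ^ j := by gcongr
    _ = _ := by ring

lemma moll_pd_bd {l : ℝ} (hl : 0 < l) {f : V2 → ℝ} (hf : Continuous f) {a : ℝ}
    (hfa : ∀ x z, ‖z - x‖ ≤ l → |f z - f x| ≤ a) (i : Fin 2) :
    SB 1 (Cm * a * l⁻¹) l⁻¹ (pd i (moll l f)) := by
  refine ⟨(moll_sm hl hf).pd i, fun j hj x => ?_⟩
  have hF : Continuous (fun y => f y - f x) := by fun_prop
  have e : pd i (moll l f) = pd i (moll l (fun y => f y - f x)) := by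
    ext z
    have : moll l (fun y => f y - f x) = fun z => moll l f z - f x := by
      ext z; rw [moll_sub l hf continuous_const, moll_const]
    rw [this, pd_sub ((moll_sm hl hf).diff z) (by fun_prop)]
    simp [pd]
  rw [e]
  refine (pd_bd_pt (moll_sm hl hF) i j x).trans ((moll_bd hl hF (fun z hz => hfa x z hz) (by omega)).trans ?_)
  rw [pow_succ]; exact le_of_eq (by ring)

lemma moll_lip {l : ℝ} (hl : 0 < l) {f : V2 → ℝ} (hf : Continuous f) {L : ℝ}
    (h : ∀ x y, |f x - f y| ≤ L * ‖x - y‖) (x y : V2) :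
    |moll l f x - moll l f y| ≤ L * ‖x - y‖ := by
  have e : moll l f x - moll l f y = moll l (fun z => f z - f (z + (y - x))) x := by
    rw [moll_sub l hf (by fun_prop)]
    congr 1
    unfold moll
    congr 1; ext z; congr 2; abel
  rw [e]
  refine moll_abs hl (by fun_prop) fun z _ => (h _ _).trans (le_of_eq ?_)
  congr 1
  rw [sub_add_cancel_left, neg_sub]

def hv2 (j : Fin 2) : V2 := fun i => if i = j then 2 else 1

def xi3 (k : Fin 3) : V2 := ![![1, 0], ![0, 1], ![1, 1]] k

lemma sqrt_piece (K1 : ℝ) (hK1 : 1 ≤ K1) : ∃ Cs : ℝ, 0 ≤ Cs ∧ ∀ (e μ : ℝ) (c : V2 → ℝ), 0 < e → 0 ≤ μ →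
    SB 3 (5 * K1 * e ^ 2) μ c → (∀ x, K1 * e ^ 2 ≤ c x) →
    ∃ b : V2 → ℝ, SB 3 (Cs * e) μ b ∧ ∀ x, b x ^ 2 / 2 = c x := by
  obtain ⟨Cs, h0, h⟩ := sqrt_SB (2 * K1) (10 * K1) (by linarith)
  refine ⟨Cs, h0, fun e μ c he hμ hc hm => ?_⟩
  have he2 : 0 < e ^ 2 := by positivity
  have hg : SB 3 (10 * K1) μ (fun x => (2 / e ^ 2) * c x) := by
    have := hc.smul (2 / e ^ 2)
    rw [abs_of_pos (by positivity)] at this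
    refine this.mono (le_of_eq ?_) (by linarith) hμ le_rfl
    field_simp; norm_num
  have hgm : ∀ x, 2 * K1 ≤ (2 / e ^ 2) * c x := fun x => by
    calc 2 * K1 = (2 / e ^ 2) * (K1 * e ^ 2) := by field_simp
      _ ≤ _ := by gcongr; exact hm x
  have hs := (h μ _ hμ hg hgm).smul e
  rw [abs_of_pos he, mul_comm] at hs
  refine ⟨_, hs, fun x => ?_⟩
  rw [mul_pow, Real.sq_sqrt (by linarith [hgm x])]
  field_simp

lemma stage : ∃ C : ℝ, 1 ≤ C ∧ ∀ (e l σ G η : ℝ) (v : V2 → ℝ) (w : Fin 2 → V2 → ℝ)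
    (A : Fin 2 → Fin 2 → V2 → ℝ), 0 < e → e ≤ 1 → 0 < l → 1 ≤ σ → 1 ≤ G →
    Sm v → (∀ j, Sm (w j)) → (∀ i j, Continuous (A i j)) → (∀ i j, A i j = A j i) →
    (∀ i j x, |A i j x - Df v w i j x| ≤ e ^ 2) →
    (∀ i x y, |pd i v x - pd i v y| ≤ e / l * ‖x - y‖) →
    (∀ i j x y, |pd i (w j) x - pd i (w j) y| ≤ G * e / l * ‖x - y‖) →
    (∀ i x, |pd i v x| ≤ G) → (∀ i j x, |pd i (w j) x| ≤ G) →
    (∀ i j x y, ‖x - y‖ ≤ l → |A i j x - A i j y| ≤ η) →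
    ∃ (v' : V2 → ℝ) (w' : Fin 2 → V2 → ℝ), Sm v' ∧ (∀ j, Sm (w' j)) ∧
      (∀ i j x, |A i j x - Df v' w' i j x| ≤ C * e ^ 2 / σ + η) ∧
      (∀ i x, |pd i v' x - pd i v x| ≤ C * e) ∧
      (∀ i j x, |pd i (w' j) x - pd i (w j) x| ≤ C * (G * e)) ∧
      (∀ i x y, |pd i v' x - pd i v' y| ≤ C * e * σ ^ 3 / l * ‖x - y‖) ∧
      (∀ i j x y, |pd i (w' j) x - pd i (w' j) y| ≤ C * (G * e) * σ ^ 3 / l * ‖x - y‖) ∧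
      (∀ x, |v' x - v x| ≤ C * (G * l)) ∧
      (∀ j x, |w' j x - w j x| ≤ C * (G * l) + C * e ^ 2 * ‖x‖) := by
  obtain ⟨K, hK, hcorr⟩ := corr3
  have hCm := Cm_ge
  set K1 : ℝ := 10 * Cm ^ 2 with hK1
  have hK11 : 1 ≤ K1 := by nlinarith
  obtain ⟨Cs, hCs, hsq⟩ := sqrt_piece K1 hK11
  set K3 : ℝ := Cs + Cm + 1 with hK3
  have hK31 : 1 ≤ K3 := by linarith
  have hKK : K * K3 ≤ K * K3 ^ 2 := by
    have : K3 ≤ K3 ^ 2 := by nlinarith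
    gcongr
  have hKK0 : 0 ≤ K * K3 ^ 2 := by positivity
  set C : ℝ := K * K3 ^ 2 + 6 * K1 + 2 with hC
  refine ⟨C, by linarith, ?_⟩
  intro e l σ G η v w A he he1 hl hσ hG hv hw hAc hAs h1 h2 h3 h4 h4w h5
  have hli : 0 < l⁻¹ := by positivity
  have hpc : ∀ i, Continuous (pd i v) := fun i => (hv.pd i).cont
  have hpw : ∀ i j, Continuous (pd i (w j)) := fun i j => ((hw j).pd i).cont
  have hv1 : ContDiff ℝ 1 v := ContDiff.of_le hv (natle 1)
  have hw1 : ∀ j, ContDiff ℝ 1 (w j) := fun j => ContDiff.of_le (hw j) (natle 1)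
  have osc : ∀ i x z, ‖z - x‖ ≤ l → |pd i v z - pd i v x| ≤ e := fun i x z hz =>
    (h2 i z x).trans (by
      calc e / l * ‖z - x‖ ≤ e / l * l := by gcongr
        _ = e := by field_simp)
  have oscw : ∀ i j x z, ‖z - x‖ ≤ l → |pd i (w j) z - pd i (w j) x| ≤ G * e := fun i j x z hz =>
    (h3 i j z x).trans (by
      calc G * e / l * ‖z - x‖ ≤ G * e / l * l := by gcongr
        _ = G * e := by field_simp)
  -- mollified functions
  set v0 : V2 → ℝ := moll l v with hv0
  have sv0 : Sm v0 := moll_sm hl hv.cont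
  have pv0 : ∀ i, pd i v0 = moll l (pd i v) := fun i => by ext x; exact moll_pd l hv1 i x
  have pw0 : ∀ i j, pd i (moll l (w j)) = moll l (pd i (w j)) := fun i j => by
    ext x; exact moll_pd l (hw1 j) i x
  set d : ℝ := 3 * (K1 * e ^ 2) with hd
  have hd0 : 0 ≤ d := by positivity
  set w0 : Fin 2 → V2 → ℝ := fun j x => moll l (w j) x - d / 2 * phase (hv2 j) x with hw0
  have sph : ∀ j, Sm (fun x => d / 2 * phase (hv2 j) x) := fun j =>
    (Sm.const _).mul (phase (hv2 j)).contDiff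
  have sw0 : ∀ j, Sm (w0 j) := fun j => (moll_sm hl (hw j).cont).sub (sph j)
  have pw0' : ∀ i j x, pd i (w0 j) x = moll l (pd i (w j)) x - d / 2 * hv2 j i := fun i j x => by
    rw [hw0]
    simp only
    rw [pd_sub ((moll_sm hl (hw j).cont).diff x) ((sph j).diff x), pw0,
      pd_const_mul _ (phase (hv2 j)).differentiableAt]
    congr 2
    simp only [pd]
    rw [ContinuousLinearMap.fderiv, phase_single]
  -- the defect
  set B : Fin 2 → Fin 2 → V2 → ℝ := fun i j x => moll l (fun y => A i j y - Df v w i j y) x +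
    (moll l (fun y => pd i v y * pd j v y) x - moll l (pd i v) x * moll l (pd j v) x) with hB
  have hDc : ∀ i j, Continuous (Df v w i j) := fun i j => by
    unfold Df; have := hpc i; have := hpc j; have := hpw i j; have := hpw j i; fun_prop
  have hBB : ∀ i j x, moll l (A i j) x = Df v0 w0 i j x + B i j x + d / 2 * (hv2 j i + hv2 i j) := by
    intro i j x
    have := hpc i; have := hpc j; have := hpw i j; have := hpw j i
    have e1 : moll l (fun y => A i j y - Df v w i j y) x = moll l (A i j) x - moll l (Df v w i j) x :=
      moll_sub l (hAc i j) (hDc i j) x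
    have e2 : moll l (Df v w i j) x = moll l (pd i (w j)) x + moll l (pd j (w i)) x +
        moll l (fun y => pd i v y * pd j v y) x := by
      unfold Df
      rw [moll_add l (by fun_prop) (by fun_prop), moll_add l (by fun_prop) (by fun_prop)]
    simp only [hB, e1, e2]
    unfold Df
    rw [pw0', pw0', pv0, pv0]
    ring
  have hBsb : ∀ i j, SB 3 (K1 * e ^ 2) l⁻¹ (B i j) := by
    intro i j
    have b1 : SB 3 (Cm * e ^ 2) l⁻¹ (moll l (fun y => A i j y - Df v w i j y)) :=
      ⟨moll_sm hl ((hAc i j).sub (hDc i j)), fun k hk x =>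
        moll_bd hl ((hAc i j).sub (hDc i j)) (fun z _ => h1 i j z) hk⟩
    have b2 := comm_bd hl (hpc i) (hpc j) (osc i) (osc j)
    refine (b1.add b2).mono ?_ (by positivity) hli.le le_rfl
    have : Cm * e ^ 2 ≤ Cm ^ 2 * e ^ 2 := by gcongr; nlinarith
    rw [hK1]; nlinarith
  have hBs : B 1 0 = B 0 1 := by
    ext x
    simp only [hB, hAs 1 0, show Df v w 1 0 = Df v w 0 1 by ext y; simp only [Df]; ring,
      show (fun y => pd 1 v y * pd 0 v y) = (fun y => pd 0 v y * pd 1 v y) by ext y; ring]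
    ring
  have hBa := fun i j x => (hBsb i j).abs_le x
  have hdsb : SB 3 d l⁻¹ (fun _ => d) := by
    refine ⟨Sm.const d, fun j hj x => ?_⟩
    rcases Nat.eq_zero_or_pos j with rfl | hj0
    · simp [abs_of_nonneg hd0]
    · rw [iteratedFDeriv_const_of_ne (by omega)]
      simp only [Pi.zero_apply, norm_zero]; positivity
  have hK0 : 0 ≤ K1 * e ^ 2 := by positivity
  obtain ⟨b0, hb0, hb0'⟩ := hsq e l⁻¹ (fun x => d + (B 0 0 x - B 0 1 x)) he hli.le
    ((hdsb.add ((hBsb 0 0).sub (hBsb 0 1))).mono (by rw [hd]; linarith) (by positivity) hli.le le_rfl)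
    (fun x => by have := abs_le.1 (hBa 0 0 x); have := abs_le.1 (hBa 0 1 x); simp only [hd]; linarith)
  obtain ⟨b1, hb1, hb1'⟩ := hsq e l⁻¹ (fun x => d + (B 1 1 x - B 0 1 x)) he hli.le
    ((hdsb.add ((hBsb 1 1).sub (hBsb 0 1))).mono (by rw [hd]; linarith) (by positivity) hli.le le_rfl)
    (fun x => by have := abs_le.1 (hBa 1 1 x); have := abs_le.1 (hBa 0 1 x); simp only [hd]; linarith)
  obtain ⟨b2, hb2, hb2'⟩ := hsq e l⁻¹ (fun x => d + B 0 1 x) he hli.le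
    ((hdsb.add (hBsb 0 1)).mono (by rw [hd]; linarith) (by positivity) hli.le le_rfl)
    (fun x => by have := abs_le.1 (hBa 0 1 x); simp only [hd]; linarith)
  have hE : Cs * e ≤ K3 * e := by gcongr; linarith
  have hbk : ∀ k, SB 3 (K3 * e) l⁻¹ ((![b0, b1, b2] : Fin 3 → V2 → ℝ) k) := by
    intro k
    fin_cases k
    · exact hb0.mono hE (by positivity) hli.le le_rfl
    · exact hb1.mono hE (by positivity) hli.le le_rfl
    · exact hb2.mono hE (by positivity) hli.le le_rfl
  have hGv : ∀ i, SB 2 (K3 * G) l⁻¹ (pd i v0) := fun i => by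
    rw [pv0]
    refine SB.mono (c := Cm * G) (μ := l⁻¹) ⟨moll_sm hl (hpc i), fun k hk x =>
      moll_bd hl (hpc i) (fun z _ => h4 i z) (by omega)⟩ ?_ (by positivity) hli.le le_rfl
    gcongr; linarith
  have h2v : ∀ i j, SB 1 (K3 * e * l⁻¹) l⁻¹ (pd i (pd j v0)) := fun i j => by
    rw [pv0]
    refine (moll_pd_bd hl (hpc j) (osc j) i).mono ?_ (by positivity) hli.le le_rfl
    gcongr; linarith
  obtain ⟨v', w', sv', sw', c1, c2, c3, c4, c5, c6, c7⟩ :=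
    hcorr (ξ := xi3) (σ := σ) sv0 sw0 (by
      intro k i; fin_cases k <;> fin_cases i <;> simp [xi3]) hli hσ (by gcongr; linarith) hbk hGv h2v
  have hsum : ∀ i j x, ∑ k, (![b0, b1, b2] : Fin 3 → V2 → ℝ) k x ^ 2 / 2 * (xi3 k i * xi3 k j)
      = B i j x + d / 2 * (hv2 j i + hv2 i j) := by
    intro i j x
    rw [Fin.sum_univ_three]
    simp only [Matrix.cons_val_zero, Matrix.cons_val_one, Matrix.cons_val_two, Matrix.head_cons,
      Matrix.tail_cons, Matrix.cons_val, hb0', hb1', hb2']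
    fin_cases i <;> fin_cases j <;> simp [xi3, hv2, hBs] <;> ring
  have heG : e ≤ G * e := by nlinarith
  have heG0 : 0 ≤ G * e := by positivity
  have hσ3 : 1 ≤ σ ^ 3 := one_le_pow₀ hσ
  refine ⟨v', w', sv', sw', fun i j x => ?_, fun i x => ?_, fun i j x => ?_, fun i x y => ?_,
    fun i j x y => ?_, fun x => ?_, fun j x => ?_⟩
  · have q1 := c7 i j x
    rw [hsum] at q1
    have q2 : |moll l (A i j) x - A i j x| ≤ η := moll_close hl (hAc i j) (fun z hz => h5 i j z x hz)
    have q3 := hBB i j x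
    have : K * (K3 * e) ^ 2 / σ ≤ C * e ^ 2 / σ := by
      rw [mul_pow, ← mul_assoc]
      gcongr
      linarith
    rw [abs_le] at q1 q2 ⊢
    constructor <;> linarith
  · have q1 := c4 i x
    have q2 : |pd i v0 x - pd i v x| ≤ e := by
      rw [pv0]; exact moll_close hl (hpc i) (osc i x)
    have : C * e = K * K3 ^ 2 * e + 6 * K1 * e + 2 * e := by rw [hC]; ring
    have t1 : K * (K3 * e) ≤ K * K3 ^ 2 * e := by rw [← mul_assoc]; gcongr
    have t2 : 0 ≤ K1 * e := by positivity
    rw [abs_le] at q1 q2 ⊢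
    constructor <;> linarith
  · have q1 := c5 i j x
    have q2 : |moll l (pd i (w j)) x - pd i (w j) x| ≤ G * e := moll_close hl (hpw i j) (oscw i j x)
    have q3 : |d / 2 * hv2 j i| ≤ d := by
      rw [abs_of_nonneg]
      · unfold hv2; split_ifs <;> linarith
      · unfold hv2; split_ifs <;> linarith
    rw [pw0'] at q1
    have : C * (G * e) = K * K3 ^ 2 * (G * e) + 6 * K1 * (G * e) + 2 * (G * e) := by rw [hC]; ring
    have t1 : K * (K3 * e * (K3 * G)) = K * K3 ^ 2 * (G * e) := by ring
    have t2 : d ≤ 3 * (K1 * (G * e)) := by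
      rw [hd]; gcongr; nlinarith
    rw [abs_le] at q1 q2 q3 ⊢
    have t3 : 0 ≤ K1 * (G * e) := by positivity
    constructor <;> linarith
  · refine (c1 i x y).trans ?_
    refine mul_le_mul_of_nonneg_right ?_ (norm_nonneg _)
    calc K * (K3 * e) * (l⁻¹ * σ ^ 3) = (K * K3) * (e * σ ^ 3 / l) := by field_simp
      _ ≤ C * (e * σ ^ 3 / l) := by gcongr; linarith
      _ = _ := by ring
  · have q1 := c6 i j x y
    rw [pw0', pw0'] at q1
    have q2 := moll_lip hl (hpw i j) (h3 i j) x y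
    have t1 : K * (K3 * e * (K3 * G)) * (l⁻¹ * σ ^ 3) = K * K3 ^ 2 * (G * e * σ ^ 3 / l) := by
      field_simp
    have t2 : G * e / l ≤ G * e * σ ^ 3 / l := by
      exact div_le_div_of_nonneg_right (le_mul_of_one_le_right heG0 hσ3) hl.le
    have t3 : 0 ≤ G * e * σ ^ 3 / l := by positivity
    have t4 : K * K3 ^ 2 * (G * e * σ ^ 3 / l) + G * e / l ≤ C * (G * e) * σ ^ 3 / l := by
      have : C * (G * e) * σ ^ 3 / l = K * K3 ^ 2 * (G * e * σ ^ 3 / l)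
        + 6 * (K1 * (G * e * σ ^ 3 / l)) + 2 * (G * e * σ ^ 3 / l) := by rw [hC]; ring
      rw [this]
      have : 0 ≤ K1 * (G * e * σ ^ 3 / l) := by positivity
      linarith
    have t5 := mul_le_mul_of_nonneg_right t4 (norm_nonneg (x - y))
    rw [add_mul] at t5
    rw [t1] at q1
    rw [abs_le] at q1 q2 ⊢
    constructor <;> linarith
  · have q1 := c2 x
    have q2 : |v0 x - v x| ≤ 2 * G * l := moll_close hl hv.cont (fun z hz =>
      (lip_of_pd hv.diff h4 z x).trans (by gcongr))
    have t1 : K * (K3 * e) / l⁻¹ ≤ K * K3 ^ 2 * (G * l) := by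
      calc K * (K3 * e) / l⁻¹ = K * K3 * (e * l) := by field_simp
        _ ≤ K * K3 ^ 2 * (G * l) := by gcongr; linarith
    have t2 : C * (G * l) = K * K3 ^ 2 * (G * l) + 6 * K1 * (G * l) + 2 * G * l := by rw [hC]; ring
    have t3 : 0 ≤ K1 * (G * l) := by positivity
    rw [abs_le] at q1 q2 ⊢
    constructor <;> linarith
  · have q1 := c3 j x
    have q2 : |moll l (w j) x - w j x| ≤ 2 * G * l := moll_close hl (hw j).cont (fun z hz =>
      (lip_of_pd (hw j).diff (fun i y => h4w i j y) z x).trans (by gcongr))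
    have q3 : |d / 2 * phase (hv2 j) x| ≤ d / 2 * (4 * ‖x‖) := by
      rw [abs_mul, abs_of_nonneg (by positivity)]
      gcongr
      refine ((phase (hv2 j)).le_opNorm x).trans ?_
      gcongr
      refine (norm_phase (hv2 j) (X := 2) fun i => ?_).trans (by norm_num)
      unfold hv2; split_ifs <;> norm_num
    have t1 : K * (K3 * e * (K3 * G)) / l⁻¹ ≤ K * K3 ^ 2 * (G * l) := by
      calc K * (K3 * e * (K3 * G)) / l⁻¹ = K * K3 ^ 2 * (e * (G * l)) := by field_simp
        _ ≤ K * K3 ^ 2 * (1 * (G * l)) := by gcongr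
        _ = _ := by ring
    have t2 : C * (G * l) = K * K3 ^ 2 * (G * l) + 6 * K1 * (G * l) + 2 * G * l := by rw [hC]; ring
    have t3 : 0 ≤ K1 * (G * l) := by positivity
    have t4 : d / 2 * (4 * ‖x‖) ≤ C * e ^ 2 * ‖x‖ := by
      rw [hd, show 3 * (K1 * e ^ 2) / 2 * (4 * ‖x‖) = (6 * K1) * e ^ 2 * ‖x‖ by ring]
      gcongr; linarith
    simp only [hw0] at q1
    rw [abs_le] at q1 q2 q3 ⊢
    constructor <;> linarith

lemma dep_seq {S : Type} (P : ℕ → S → Prop) (R : ℕ → S → S → Prop) (x0 : S) (h0 : P 0 x0)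
    (hs : ∀ q x, P q x → ∃ y, P (q + 1) y ∧ R q x y) :
    ∃ f : ℕ → S, f 0 = x0 ∧ (∀ q, P q (f q)) ∧ ∀ q, R q (f q) (f (q + 1)) := by
  choose! g hg using hs
  let F : ∀ q, {x : S // P q x} := fun q =>
    Nat.rec (motive := fun q => {x : S // P q x}) ⟨x0, h0⟩ (fun q x => ⟨g q x.1, (hg q x.1 x.2).1⟩) q
  exact ⟨fun q => (F q).1, rfl, fun q => (F q).2, fun q => (hg q (F q).1 (F q).2).2⟩

lemma interp {t p q α : ℝ} (ht : 0 ≤ t) (hp : t ≤ p) (hq : t ≤ q) (h0 : 0 ≤ α) (h1 : α ≤ 1) :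
    t ≤ p ^ (1 - α) * q ^ α := by
  rcases ht.eq_or_lt with rfl | ht'
  · positivity
  calc t = t ^ (1 - α) * t ^ α := by rw [← Real.rpow_add ht']; simp
    _ ≤ _ := by
      have : 0 ≤ 1 - α := by linarith
      have : 0 ≤ p := ht.trans hp
      gcongr

lemma fderiv_phase (f : V2 → ℝ) (x : V2) : fderiv ℝ f x = phase (fun i => pd i f x) := by
  ext1 y
  rw [fderiv_eq_pd, phase_apply]; ring

lemma phase_sub (a b : V2) : phase a - phase b = phase (a - b) := by
  ext1 y; simp only [_root_.sub_apply, phase_apply, Pi.sub_apply]; ring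

lemma limit_lemma {f : ℕ → V2 → ℝ} {a ρ M Λ G α : ℝ} {u : V2 → ℝ}
    (hf : ∀ q, Differentiable ℝ (f q)) (hρ0 : 0 < ρ) (hρ : ρ ≤ 1 / 2) (hΛ : 1 ≤ Λ) (ha : 0 ≤ a)
    (hM : 0 ≤ M) (hα0 : 0 < α) (hα1 : α < 1) (hs : ρ ^ (1 - α) * Λ ^ α < 1)
    (h1 : ∀ q i x, |pd i (f (q + 1)) x - pd i (f q) x| ≤ a * ρ ^ q)
    (h2 : ∀ q i x y, |pd i (f q) x - pd i (f q) y| ≤ M * Λ ^ q * ‖x - y‖)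
    (h3 : ∀ i x, |pd i (f 0) x| ≤ G)
    (h4 : ∀ q x, |f (q + 1) x - f q x| ≤ u x / 2 * (1 / 2) ^ q) :
    ∃ F : V2 → ℝ, Differentiable ℝ F ∧ (∀ x, |F x - f 0 x| ≤ u x) ∧
      (∀ i x, Filter.Tendsto (fun q => pd i (f q) x) Filter.atTop (𝓝 (pd i F x))) ∧
      ∃ H : ℝ, ∀ i x y, |pd i F x - pd i F y| ≤ H * ‖x - y‖ ^ α := by
  have hρ1 : ρ < 1 := by linarith
  have d4 : ∀ x q, dist (f q x) (f (q + 1) x) ≤ u x / 2 * (1 / 2) ^ q := fun x q => by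
    rw [dist_comm, Real.dist_eq]; exact h4 q x
  have d1 : ∀ i x q, dist (pd i (f q) x) (pd i (f (q + 1)) x) ≤ a * ρ ^ q := fun i x q => by
    rw [dist_comm, Real.dist_eq]; exact h1 q i x
  have c4 : ∀ x, ∃ F, Filter.Tendsto (fun q => f q x) Filter.atTop (𝓝 F) := fun x =>
    cauchySeq_tendsto_of_complete (cauchySeq_of_le_geometric _ _ (by norm_num) (d4 x))
  have c1 : ∀ i x, ∃ F, Filter.Tendsto (fun q => pd i (f q) x) Filter.atTop (𝓝 F) := fun i x =>
    cauchySeq_tendsto_of_complete (cauchySeq_of_le_geometric _ _ hρ1 (d1 i x))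
  choose F hF using c4
  choose g hg using c1
  have hgd : ∀ i x q, |pd i (f q) x - g i x| ≤ a * ρ ^ q / (1 - ρ) := fun i x q => by
    rw [← Real.dist_eq]; exact dist_le_of_le_geometric_of_tendsto _ _ hρ1 (d1 i x) (hg i x) q
  have hder : ∀ x, HasFDerivAt F (phase (fun i => g i x)) x := by
    refine hasFDerivAt_of_tendstoUniformly (f := f) (l := Filter.atTop)
      (f' := fun q x => phase (fun i => pd i (f q) x)) (g' := fun x => phase (fun i => g i x)) ?_ ?_ hF
    · rw [Metric.tendstoUniformly_iff]
      intro ε hε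
      have ht : Filter.Tendsto (fun q : ℕ => 2 * (a * ρ ^ q / (1 - ρ))) Filter.atTop (𝓝 (2 * (a * 0 / (1 - ρ)))) :=
        (((tendsto_pow_atTop_nhds_zero_of_lt_one hρ0.le hρ1).const_mul a).div_const _).const_mul 2
      rw [mul_zero, zero_div, mul_zero] at ht
      filter_upwards [ht.eventually_lt_const hε] with q hq x
      rw [dist_comm, dist_eq_norm, phase_sub]
      exact (norm_phase _ fun i => hgd i x q).trans_lt hq
    · intro q x
      rw [← fderiv_phase]
      exact (hf q x).hasFDerivAt
  have hpd : ∀ i x, pd i F x = g i x := fun i x => by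
    simp only [pd]; rw [(hder x).fderiv, phase_single]
  refine ⟨F, fun x => (hder x).differentiableAt, fun x => ?_, fun i x => by rw [hpd]; exact hg i x, ?_⟩
  · have := dist_le_of_le_geometric_of_tendsto₀ _ _ (by norm_num) (d4 x) (hF x)
    rw [dist_comm, Real.dist_eq] at this
    refine this.trans (le_of_eq ?_); ring
  · set s := ρ ^ (1 - α) * Λ ^ α with hsd
    have hs0 : 0 ≤ s := by positivity
    have hΛ0 : 0 < Λ := by linarith
    have hG : 0 ≤ G := (abs_nonneg _).trans (h3 0 0)
    set c := (2 * a) ^ (1 - α) * (2 * M * Λ) ^ α with hc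
    have hc0 : 0 ≤ c := by positivity
    refine ⟨(2 * G) ^ (1 - α) * M ^ α + c / (1 - s), fun i x y => ?_⟩
    set r := ‖x - y‖ with hr
    have hr0 : 0 ≤ r := norm_nonneg _
    have b0 : |pd i (f 0) x - pd i (f 0) y| ≤ (2 * G) ^ (1 - α) * M ^ α * r ^ α := by
      rw [mul_assoc, ← Real.mul_rpow hM hr0]
      refine interp (abs_nonneg _) ?_ ?_ hα0.le hα1.le
      · refine (abs_sub _ _).trans ?_
        linarith [h3 i x, h3 i y]
      · simpa using h2 0 i x y
    have bq : ∀ q, dist (pd i (f q) x - pd i (f q) y) (pd i (f (q + 1)) x - pd i (f (q + 1)) y)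
        ≤ c * r ^ α * s ^ q := by
      intro q
      have k1 : |(pd i (f (q + 1)) x - pd i (f (q + 1)) y) - (pd i (f q) x - pd i (f q) y)|
          ≤ 2 * a * ρ ^ q := by
        have q1 := h1 q i x
        have q2 := h1 q i y
        rw [abs_le] at q1 q2 ⊢
        constructor <;> linarith
      have k2 : |(pd i (f (q + 1)) x - pd i (f (q + 1)) y) - (pd i (f q) x - pd i (f q) y)|
          ≤ 2 * M * Λ * Λ ^ q * r := by
        refine (abs_sub _ _).trans ?_
        have q1 := h2 (q + 1) i x y
        have q2 := h2 q i x y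
        have q3 : M * Λ ^ q * r ≤ M * Λ ^ (q + 1) * r := by
          gcongr
          omega
        calc _ ≤ M * Λ ^ (q + 1) * r + M * Λ ^ (q + 1) * r := by linarith
          _ = _ := by rw [pow_succ]; ring
      rw [dist_comm, Real.dist_eq]
      refine (interp (abs_nonneg _) k1 k2 hα0.le hα1.le).trans (le_of_eq ?_)
      rw [Real.mul_rpow (x := 2 * a) (by positivity) (by positivity),
        Real.mul_rpow (x := 2 * M * Λ * Λ ^ q) (by positivity) hr0,
        Real.mul_rpow (x := 2 * M * Λ) (by positivity) (by positivity), hc, hsd, mul_pow,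
        ← Real.rpow_natCast, ← Real.rpow_natCast, ← Real.rpow_natCast, ← Real.rpow_natCast,
        ← Real.rpow_mul hρ0.le, ← Real.rpow_mul hΛ0.le, ← Real.rpow_mul hρ0.le, ← Real.rpow_mul hΛ0.le,
        mul_comm (q : ℝ) (1 - α), mul_comm (q : ℝ) α]
      ring
    have lim : Filter.Tendsto (fun q => pd i (f q) x - pd i (f q) y) Filter.atTop (𝓝 (pd i F x - pd i F y)) := by
      rw [hpd, hpd]; exact (hg i x).sub (hg i y)
    have := dist_le_of_le_geometric_of_tendsto₀ _ _ hs bq lim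
    rw [Real.dist_eq] at this
    have e : ((2 * G) ^ (1 - α) * M ^ α + c / (1 - s)) * r ^ α =
      (2 * G) ^ (1 - α) * M ^ α * r ^ α + c * r ^ α / (1 - s) := by ring
    rw [e]
    rw [abs_le] at this b0 ⊢
    constructor <;> linarith

lemma params (C α β : ℝ) (hC : 1 ≤ C) (hβ0 : 0 < β) (hβ1 : β < 1) (hα0 : 0 < α)
    (hα : α < min (1 / 7 : ℝ) (β / 2)) : ∃ σ ρ : ℝ, 1 ≤ σ ∧ 0 < ρ ∧ ρ ≤ 1 / 2 ∧
      C / σ ≤ ρ ^ 2 / 2 ∧ (ρ / (C * σ ^ 3)) ^ β ≤ ρ ^ 2 ∧ ρ ^ (1 - α) * (C * σ ^ 3) ^ α < 1 := by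
  obtain ⟨h7, hb⟩ := lt_min_iff.1 hα
  have ha1 : 0 < 1 - α := by linarith
  have k1 : α / (1 - α) < 1 / 6 := by rw [div_lt_div_iff₀ ha1 (by norm_num)]; linarith
  have k2 : α / (1 - α) < β / (2 - β) := by
    rw [div_lt_div_iff₀ ha1 (by linarith)]; nlinarith
  obtain ⟨τ, t1, t2⟩ := exists_between (lt_min k1 k2)
  obtain ⟨t3, t4⟩ := lt_min_iff.1 t2
  have t0 : 0 < τ := lt_trans (by positivity) t1
  rw [div_lt_iff₀ ha1] at t1
  rw [lt_div_iff₀ (by linarith)] at t4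
  have C0 : 0 < C := by linarith
  -- choose sigma
  have T1 : Filter.Tendsto (fun σ : ℝ => C * σ ^ 3) Filter.atTop Filter.atTop :=
    (Filter.tendsto_pow_atTop (by norm_num)).const_mul_atTop C0
  have T2 : Filter.Tendsto (fun σ : ℝ => (C * σ ^ 3) ^ (-τ)) Filter.atTop (𝓝 0) :=
    (tendsto_rpow_neg_atTop t0).comp T1
  have T3 : Filter.Tendsto (fun σ : ℝ => 2 * C * C ^ (2 * τ) * σ ^ (-(1 - 6 * τ))) Filter.atTop (𝓝 0) := by
    have := (tendsto_rpow_neg_atTop (y := 1 - 6 * τ) (by linarith)).const_mul (2 * C * C ^ (2 * τ))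
    rwa [mul_zero] at this
  obtain ⟨σ, ⟨hs1, hs2⟩, hs3⟩ := (((T2.eventually_le_const (show (0:ℝ) < 1 / 2 by norm_num)).and
    (T3.eventually_le_const (show (0:ℝ) < 1 by norm_num))).and (Filter.eventually_gt_atTop 1)).exists
  have σ0 : 0 < σ := by linarith
  set Λ := C * σ ^ 3 with hΛ
  have hΛ1 : 1 < Λ := by
    have : 1 < σ ^ 3 := one_lt_pow₀ hs3 (by norm_num)
    rw [hΛ]; nlinarith
  have Λ0 : 0 < Λ := by linarith
  refine ⟨σ, Λ ^ (-τ), hs3.le, by positivity, hs1, ?_, ?_, ?_⟩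
  · have e1 : (Λ ^ (-τ)) ^ 2 = C ^ (-(2 * τ)) * σ ^ (-(6 * τ)) := by
      rw [← Real.rpow_natCast, ← Real.rpow_mul Λ0.le, hΛ, Real.mul_rpow C0.le (by positivity),
        ← Real.rpow_natCast σ 3, ← Real.rpow_mul σ0.le]
      congr 2
      · push_cast; ring
      · push_cast; ring
    have e2 : σ ^ (-(1 - 6 * τ)) = σ⁻¹ * (σ ^ (-(6 * τ)))⁻¹ := by
      rw [← Real.rpow_neg σ0.le, neg_neg, ← Real.rpow_neg_one, ← Real.rpow_add σ0]; congr 1; ring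
    have e3 : C ^ (2 * τ) = (C ^ (-(2 * τ)))⁻¹ := by rw [← Real.rpow_neg C0.le, neg_neg]
    rw [e1]
    rw [e2, e3] at hs2
    have p1 : 0 < C ^ (-(2 * τ)) := by positivity
    have p2 : 0 < σ ^ (-(6 * τ)) := by positivity
    have : 2 * C * (C ^ (-(2 * τ)))⁻¹ * (σ⁻¹ * (σ ^ (-(6 * τ)))⁻¹) = (2 * C / σ) / (C ^ (-(2 * τ)) * σ ^ (-(6 * τ))) := by
      field_simp
    rw [this, div_le_one (by positivity)] at hs2
    have e4 : 2 * C / σ = 2 * (C / σ) := by ring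
    linarith
  · have e1 : Λ ^ (-τ) / Λ = Λ ^ (-τ - 1) := by rw [Real.rpow_sub_one Λ0.ne']
    rw [e1, ← Real.rpow_mul Λ0.le, ← Real.rpow_natCast, ← Real.rpow_mul Λ0.le]
    apply Real.rpow_le_rpow_of_exponent_le hΛ1.le
    push_cast; nlinarith
  · rw [← Real.rpow_mul Λ0.le, ← Real.rpow_add Λ0]
    apply Real.rpow_lt_one_of_one_lt_of_neg hΛ1
    nlinarith

lemma iter (α β : ℝ) (hβ0 : 0 < β) (hβ1 : β < 1) (hα0 : 0 < α) (hα : α < min (1 / 7 : ℝ) (β / 2)) :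
    ∃ es C' : ℝ, 0 < es ∧ 0 < C' ∧ ∀ (e0 θ G0 L H : ℝ) (v0 : V2 → ℝ) (w0 : Fin 2 → V2 → ℝ)
      (A : Fin 2 → Fin 2 → V2 → ℝ), 0 < e0 → e0 ≤ es → 0 < θ → 1 ≤ G0 →
      Sm v0 → (∀ j, Sm (w0 j)) → (∀ i j, Continuous (A i j)) → (∀ i j, A i j = A j i) →
      (∀ i j x, |A i j x - Df v0 w0 i j x| ≤ e0 ^ 2) →
      (∀ i x y, |pd i v0 x - pd i v0 y| ≤ L * ‖x - y‖) →
      (∀ i j x y, |pd i (w0 j) x - pd i (w0 j) y| ≤ L * ‖x - y‖) →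
      (∀ i x, |pd i v0 x| ≤ G0) → (∀ i j x, |pd i (w0 j) x| ≤ G0) →
      (∀ i j x y, ‖x - y‖ ≤ 1 → |A i j x - A i j y| ≤ H * ‖x - y‖ ^ β) →
      ∃ (v : V2 → ℝ) (w : Fin 2 → V2 → ℝ), Differentiable ℝ v ∧ (∀ j, Differentiable ℝ (w j)) ∧
        (∀ x, |v x - v0 x| ≤ θ) ∧ (∀ j x, |w j x - w0 j x| ≤ θ + C' * e0 ^ 2 * ‖x‖) ∧
        (∃ Hc, ∀ i x y, |pd i v x - pd i v y| ≤ Hc * ‖x - y‖ ^ α) ∧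
        (∀ j, ∃ Hc, ∀ i x y, |pd i (w j) x - pd i (w j) y| ≤ Hc * ‖x - y‖ ^ α) ∧
        ∀ i j x, Df v w i j x = A i j x := by
  obtain ⟨C, hC, hst⟩ := stage
  obtain ⟨σ, ρ, hσ, hρ0, hρ, p1, p2, p3⟩ := params C α β hC hβ0 hβ1 hα0 hα
  have C0 : 0 < C := by linarith
  set Λ := C * σ ^ 3 with hΛ
  have hσ3 : 1 ≤ σ ^ 3 := one_le_pow₀ hσ
  have hΛ1 : 1 ≤ Λ := by rw [hΛ]; nlinarith
  have Λ0 : 0 < Λ := by linarith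
  set κ := ρ / Λ with hκ
  have κ0 : 0 < κ := by positivity
  have hκρ : κ ≤ ρ := div_le_self hρ0.le hΛ1
  have hκ2 : κ ≤ 1 / 2 := hκρ.trans hρ
  refine ⟨1 / (4 * C), 2 * C, by positivity, by positivity, ?_⟩
  intro e0 θ G0 L H v0 w0 A he0 hes hθ hG0 hv0 hw0 hAc hAs h1 h2 h3 h4 h4w h5
  set G := 2 * G0 with hG
  have hes' : 4 * C * e0 ≤ 1 := by
    rw [le_div_iff₀ (by positivity)] at hes; linarith
  have he01 : e0 ≤ 1 := by nlinarith
  have G0' : 0 < G := by linarith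
  -- choice of the initial length scale
  have T1 : Filter.Tendsto (fun l : ℝ => |H| * l ^ β) (𝓝[>] 0) (𝓝 0) := by
    have : Filter.Tendsto (fun l : ℝ => |H| * l ^ β) (𝓝 0) (𝓝 (|H| * 0 ^ β)) :=
      ((Real.continuous_rpow_const hβ0.le).tendsto 0).const_mul _
    rw [Real.zero_rpow hβ0.ne', mul_zero] at this
    exact this.mono_left nhdsWithin_le_nhds
  have T2 : Filter.Tendsto (fun l : ℝ => 2 * C * G * l) (𝓝[>] 0) (𝓝 0) := by
    have : Filter.Tendsto (fun l : ℝ => 2 * C * G * l) (𝓝 0) (𝓝 (2 * C * G * 0)) :=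
      (continuous_const.mul continuous_id).tendsto 0
    rw [mul_zero] at this
    exact this.mono_left nhdsWithin_le_nhds
  have T3 : Filter.Tendsto (fun l : ℝ => |L| * l) (𝓝[>] 0) (𝓝 0) := by
    have : Filter.Tendsto (fun l : ℝ => |L| * l) (𝓝 0) (𝓝 (|L| * 0)) :=
      (continuous_const.mul continuous_id).tendsto 0
    rw [mul_zero] at this
    exact this.mono_left nhdsWithin_le_nhds
  have T4 : Filter.Tendsto (fun l : ℝ => l) (𝓝[>] 0) (𝓝 0) := nhdsWithin_le_nhds
  obtain ⟨l0, ⟨⟨⟨⟨q1, q2⟩, q3⟩, q4⟩, q5⟩⟩ := (((((T1.eventually_le_const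
    (show (0:ℝ) < ρ ^ 2 * e0 ^ 2 / 2 by positivity)).and (T2.eventually_le_const hθ)).and
    (T3.eventually_le_const he0)).and (T4.eventually_le_const one_pos)).and
    (eventually_mem_nhdsWithin (a := (0:ℝ)) (s := Set.Ioi 0))).exists
  have l0p : 0 < l0 := q5
  have hH : ∀ q : ℕ, |H| * (l0 * κ ^ q) ^ β ≤ (e0 * ρ ^ (q + 1)) ^ 2 / 2 := by
    intro q
    rw [Real.mul_rpow l0p.le (by positivity), ← Real.rpow_natCast, ← Real.rpow_mul κ0.le,
      mul_comm (q : ℝ) β, Real.rpow_mul κ0.le, Real.rpow_natCast]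
    calc |H| * (l0 ^ β * (κ ^ β) ^ q) = |H| * l0 ^ β * (κ ^ β) ^ q := by ring
      _ ≤ ρ ^ 2 * e0 ^ 2 / 2 * (ρ ^ 2) ^ q := by gcongr
      _ = _ := by ring
  have hlow : ∀ q : ℕ, l0 * κ ^ q ≤ 1 := fun q =>
    mul_le_one₀ q4 (by positivity) (pow_le_one₀ κ0.le (by linarith))
  have hratio : ∀ q : ℕ, e0 * ρ ^ q / (l0 * κ ^ q) = e0 / l0 * Λ ^ q := fun q => by
    rw [hκ, div_pow]; field_simp
  -- the sequence
  obtain ⟨F, hF0, hP, hR⟩ := dep_seq (S := (V2 → ℝ) × (Fin 2 → V2 → ℝ))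
    (fun q p => Sm p.1 ∧ (∀ j, Sm (p.2 j)) ∧
      (∀ i j x, |A i j x - Df p.1 p.2 i j x| ≤ (e0 * ρ ^ q) ^ 2) ∧
      (∀ i x y, |pd i p.1 x - pd i p.1 y| ≤ e0 / l0 * Λ ^ q * ‖x - y‖) ∧
      (∀ i j x y, |pd i (p.2 j) x - pd i (p.2 j) y| ≤ G * (e0 / l0) * Λ ^ q * ‖x - y‖) ∧
      (∀ i x, |pd i p.1 x| ≤ G0 + 2 * C * G * (e0 - e0 * ρ ^ q)) ∧
      (∀ i j x, |pd i (p.2 j) x| ≤ G0 + 2 * C * G * (e0 - e0 * ρ ^ q)))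
    (fun q p p' => (∀ i x, |pd i p'.1 x - pd i p.1 x| ≤ C * G * e0 * ρ ^ q) ∧
      (∀ i j x, |pd i (p'.2 j) x - pd i (p.2 j) x| ≤ C * G * e0 * ρ ^ q) ∧
      (∀ x, |p'.1 x - p.1 x| ≤ θ / 2 * (1 / 2) ^ q) ∧
      (∀ j x, |p'.2 j x - p.2 j x| ≤ (θ + 2 * C * e0 ^ 2 * ‖x‖) / 2 * (1 / 2) ^ q))
    (v0, w0)
    (by
      have hLl : L ≤ e0 / l0 := by
        rw [le_div_iff₀ l0p]; exact (mul_le_mul_of_nonneg_right (le_abs_self L) l0p.le).trans q3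
      refine ⟨hv0, hw0, by simpa using h1, fun i x y => (h2 i x y).trans ?_,
        fun i j x y => (h3 i j x y).trans ?_, fun i x => by simpa using h4 i x,
        fun i j x => by simpa using h4w i j x⟩
      · simp only [pow_zero, mul_one]; gcongr
      · simp only [pow_zero, mul_one]
        refine mul_le_mul_of_nonneg_right (hLl.trans ?_) (norm_nonneg _)
        exact le_mul_of_one_le_left (by positivity) (by linarith))
    (by
      rintro q ⟨v, w⟩ ⟨s1, s2, s3, s4, s5, s6, s7⟩
      simp only at s1 s2 s3 s4 s5 s6 s7
      have hρq : ρ ^ q ≤ 1 := pow_le_one₀ hρ0.le (by linarith)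
      have hρq0 : 0 < ρ ^ q := by positivity
      have heq : 0 < e0 * ρ ^ q := by positivity
      have heq1 : e0 * ρ ^ q ≤ e0 := mul_le_of_le_one_right he0.le hρq
      have hGb : G0 + 2 * C * G * (e0 - e0 * ρ ^ q) ≤ G := by
        have : 2 * C * G * (e0 - e0 * ρ ^ q) ≤ 2 * C * G * e0 :=
          mul_le_mul_of_nonneg_left (by linarith) (by positivity)
        have e1 : 2 * C * G * e0 = (4 * C * e0) * G0 := by rw [hG]; ring
        have : (4 * C * e0) * G0 ≤ 1 * G0 := by gcongr
        linarith
      obtain ⟨v', w', r1, r2, r3, r4, r5, r6, r7, r8, r9⟩ := hst (e0 * ρ ^ q) (l0 * κ ^ q) σ G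
        ((e0 * ρ ^ (q + 1)) ^ 2 / 2) v w A heq (heq1.trans he01) (by positivity) hσ (by linarith)
        s1 s2 hAc hAs s3 (by rw [hratio]; exact s4)
        (by
          intro i j x y
          rw [mul_div_assoc, hratio, ← mul_assoc]; exact s5 i j x y)
        (fun i x => (s6 i x).trans hGb) (fun i j x => (s7 i j x).trans hGb)
        (fun i j x y hxy => by
          refine (h5 i j x y (hxy.trans (hlow q))).trans (le_trans ?_ (hH q))
          exact mul_le_mul (le_abs_self H) (Real.rpow_le_rpow (norm_nonneg _) hxy hβ0.le)
            (by positivity) (abs_nonneg _))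
      have hstep : C * (G * (e0 * ρ ^ q)) ≤ 2 * C * G * (e0 * ρ ^ q - e0 * ρ ^ (q + 1)) := by
        have : e0 * ρ ^ (q + 1) ≤ e0 * ρ ^ q * (1 / 2) := by rw [pow_succ, ← mul_assoc]; gcongr
        have h' : e0 * ρ ^ q / 2 ≤ e0 * ρ ^ q - e0 * ρ ^ (q + 1) := by linarith
        calc C * (G * (e0 * ρ ^ q)) = 2 * C * G * (e0 * ρ ^ q / 2) := by ring
          _ ≤ _ := by gcongr
      have hstepv : C * (e0 * ρ ^ q) ≤ C * (G * (e0 * ρ ^ q)) :=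
        mul_le_mul_of_nonneg_left (le_mul_of_one_le_left heq.le
          (by linarith : (1:ℝ) ≤ G)) C0.le
      have hlq : C * (G * (l0 * κ ^ q)) ≤ θ / 2 * (1 / 2) ^ q := by
        calc C * (G * (l0 * κ ^ q)) = (2 * C * G * l0) / 2 * κ ^ q := by ring
          _ ≤ _ := by gcongr
      refine ⟨(v', w'), ⟨r1, r2, fun i j x => (r3 i j x).trans ?_, fun i x y => (r6 i x y).trans ?_,
        fun i j x y => (r7 i j x y).trans ?_, fun i x => ?_, fun i j x => ?_⟩,
        fun i x => (r4 i x).trans (hstepv.trans (le_of_eq (by ring))),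
        fun i j x => (r5 i j x).trans (le_of_eq (by ring)),
        fun x => (r8 x).trans hlq, fun j x => (r9 j x).trans ?_⟩
      · have : C * (e0 * ρ ^ q) ^ 2 / σ ≤ (e0 * ρ ^ (q + 1)) ^ 2 / 2 := by
          calc C * (e0 * ρ ^ q) ^ 2 / σ = C / σ * (e0 * ρ ^ q) ^ 2 := by ring
            _ ≤ ρ ^ 2 / 2 * (e0 * ρ ^ q) ^ 2 := by gcongr
            _ = _ := by ring
        linarith
      · refine mul_le_mul_of_nonneg_right (le_of_eq ?_) (norm_nonneg _)
        calc C * (e0 * ρ ^ q) * σ ^ 3 / (l0 * κ ^ q) = Λ * (e0 * ρ ^ q / (l0 * κ ^ q)) := by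
              rw [hΛ]; ring
          _ = _ := by rw [hratio]; ring
      · refine mul_le_mul_of_nonneg_right (le_of_eq ?_) (norm_nonneg _)
        calc C * (G * (e0 * ρ ^ q)) * σ ^ 3 / (l0 * κ ^ q) = Λ * G * (e0 * ρ ^ q / (l0 * κ ^ q)) := by
              rw [hΛ]; ring
          _ = _ := by rw [hratio]; ring
      · have t1 := r4 i x
        have t2 := s6 i x
        have t3 : |pd i v' x| ≤ |pd i v' x - pd i v x| + |pd i v x| := by
          have := abs_add_le (pd i v' x - pd i v x) (pd i v x)
          rwa [sub_add_cancel] at this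
        simp only
        nlinarith
      · have t1 := r5 i j x
        have t2 := s7 i j x
        have t3 : |pd i (w' j) x| ≤ |pd i (w' j) x - pd i (w j) x| + |pd i (w j) x| := by
          have := abs_add_le (pd i (w' j) x - pd i (w j) x) (pd i (w j) x)
          rwa [sub_add_cancel] at this
        simp only
        nlinarith
      · have t1 : C * (e0 * ρ ^ q) ^ 2 * ‖x‖ ≤ C * e0 ^ 2 * ‖x‖ * (1 / 2) ^ q := by
          have : (ρ ^ q) ^ 2 ≤ (1 / 2) ^ q := by
            calc (ρ ^ q) ^ 2 ≤ ρ ^ q := by rw [pow_two]; exact mul_le_of_le_one_left hρq0.le hρq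
              _ ≤ _ := by gcongr
          calc C * (e0 * ρ ^ q) ^ 2 * ‖x‖ = C * e0 ^ 2 * ‖x‖ * (ρ ^ q) ^ 2 := by ring
            _ ≤ _ := by gcongr
        calc _ ≤ θ / 2 * (1 / 2) ^ q + C * e0 ^ 2 * ‖x‖ * (1 / 2) ^ q := add_le_add hlq t1
          _ = _ := by ring)
  have hα1 : α < 1 := by
    have := (lt_min_iff.1 hα).1; linarith
  obtain ⟨v, dv, nv, tv, Hv⟩ := limit_lemma (f := fun q => (F q).1) (a := C * G * e0) (ρ := ρ)
    (M := e0 / l0) (Λ := Λ) (G := G0) (α := α) (u := fun _ => θ) (fun q => ((hP q).1).diff) hρ0 hρ hΛ1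
    (by positivity) (by positivity) hα0 hα1 p3 (fun q i x => (hR q).1 i x)
    (fun q i x y => (hP q).2.2.2.1 i x y) (by rw [hF0]; exact h4) (fun q x => (hR q).2.2.1 x)
  have hw := fun j => limit_lemma (f := fun q => (F q).2 j) (a := C * G * e0) (ρ := ρ)
    (M := G * (e0 / l0)) (Λ := Λ) (G := G0) (α := α) (u := fun x => θ + 2 * C * e0 ^ 2 * ‖x‖)
    (fun q => ((hP q).2.1 j).diff) hρ0 hρ hΛ1
    (by positivity) (by positivity) hα0 hα1 p3 (fun q i x => (hR q).2.1 i j x)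
    (fun q i x y => (hP q).2.2.2.2.1 i j x y) (by rw [hF0]; exact fun i x => h4w i j x)
    (fun q x => (hR q).2.2.2 j x)
  choose w dw nw tw Hw using hw
  refine ⟨v, w, dv, dw, ?_, ?_, Hv, Hw, fun i j x => ?_⟩
  · simpa only [hF0] using nv
  · simpa only [hF0] using nw
  · have l1 : Filter.Tendsto (fun q => Df (F q).1 (F q).2 i j x) Filter.atTop (𝓝 (Df v w i j x)) :=
      ((tw j i x).add (tw i j x)).add ((tv i x).mul (tv j x))
    have l2 : Filter.Tendsto (fun q => Df (F q).1 (F q).2 i j x) Filter.atTop (𝓝 (A i j x)) := by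
      have hz : Filter.Tendsto (fun q : ℕ => (e0 * ρ ^ q) ^ 2) Filter.atTop (𝓝 0) := by
        have := (((tendsto_pow_atTop_nhds_zero_of_lt_one hρ0.le (by linarith)).const_mul e0).pow 2)
        simpa using this
      rw [tendsto_iff_dist_tendsto_zero]
      refine squeeze_zero (fun _ => dist_nonneg) (fun q => ?_) hz
      rw [dist_comm, Real.dist_eq]
      exact (hP q).2.2.1 i j x
    exact tendsto_nhds_unique l1 l2

lemma mcshane {K : Set V2} (hne : K.Nonempty) (f : V2 → ℝ) {H β B : ℝ} (hH : 0 ≤ H) (hβ0 : 0 < β)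
    (hβ1 : β ≤ 1) (hf : ∀ x ∈ K, ∀ y ∈ K, |f x - f y| ≤ H * ‖x - y‖ ^ β)
    (hB : ∀ x ∈ K, |f x| ≤ B) :
    ∃ g : V2 → ℝ, (∀ x ∈ K, g x = f x) ∧ (∀ x y, |g x - g y| ≤ H * ‖x - y‖ ^ β) ∧
      ∀ x, |g x| ≤ B := by
  have : Nonempty K := hne.to_subtype
  set g : V2 → ℝ := fun x => ⨅ y : K, (f y + H * ‖x - y‖ ^ β) with hg
  have hb : ∀ x : V2, BddBelow (Set.range fun y : K => (f y + H * ‖x - y‖ ^ β)) := by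
    intro x
    refine ⟨-B, ?_⟩
    rintro _ ⟨y, rfl⟩
    have h1 := (abs_le.1 (hB y y.2)).1
    have h2 : 0 ≤ H * ‖x - y‖ ^ β := by positivity
    simp only; linarith
  have htri : ∀ x y z : V2, ‖x - z‖ ^ β ≤ ‖x - y‖ ^ β + ‖y - z‖ ^ β := by
    intro x y z
    have : ‖x - z‖ ≤ ‖x - y‖ + ‖y - z‖ := norm_sub_le_norm_sub_add_norm_sub x y z
    exact (Real.rpow_le_rpow (norm_nonneg _) this hβ0.le).trans
      (Real.rpow_add_le_add_rpow (norm_nonneg _) (norm_nonneg _) hβ0.le hβ1)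
  have hg1 : ∀ x ∈ K, g x = f x := by
    intro x hx
    refine le_antisymm ?_ ?_
    · have := ciInf_le (hb x) ⟨x, hx⟩
      simpa [hg, Real.zero_rpow hβ0.ne'] using this
    · refine le_ciInf fun y => ?_
      have := (abs_le.1 (hf x hx y y.2)).2
      linarith
  have hg2 : ∀ x y, g x ≤ g y + H * ‖x - y‖ ^ β := by
    intro x y
    rw [← sub_le_iff_le_add]
    refine le_ciInf fun z => ?_
    have h1 := ciInf_le (hb x) z
    have h2 := mul_le_mul_of_nonneg_left (htri x y z) hH
    change g x ≤ _ at h1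
    linarith
  have hg3 : ∀ x y, |g x - g y| ≤ H * ‖x - y‖ ^ β := by
    intro x y
    have h1 := hg2 x y
    have h2 := hg2 y x
    rw [norm_sub_rev] at h2
    rw [abs_le]; constructor <;> linarith
  refine ⟨fun x => max (-B) (min B (g x)), ?_, ?_, ?_⟩
  · intro x hx
    have := abs_le.1 (hB x hx)
    simp only [hg1 x hx]
    rw [min_eq_right this.2, max_eq_right this.1]
  · intro x y
    refine le_trans ?_ (hg3 x y)
    refine (abs_max_sub_max_le_max _ _ _ _).trans ?_
    simp only [sub_self, abs_zero]
    refine max_le (abs_nonneg _) ?_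
    refine (abs_min_sub_min_le_max _ _ _ _).trans ?_
    simp
  · intro x
    obtain ⟨y, hy⟩ := hne
    have hB0 : 0 ≤ B := (abs_nonneg _).trans (hB y hy)
    rw [abs_le]
    exact ⟨le_max_left _ _, max_le (by linarith) (min_le_left _ _)⟩

lemma cutoff {K U : Set V2} (hK : IsCompact K) (hU : IsOpen U) (hKU : K ⊆ U) :
    ∃ χ : V2 → ℝ, Sm χ ∧ HasCompactSupport χ ∧ tsupport χ ⊆ U ∧ ∀ x ∈ K, ∀ᶠ y in 𝓝 x, χ y = 1 := by
  obtain ⟨t, ht, h1, h2⟩ := exists_compact_between hK hU hKU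
  obtain ⟨χ, c1, c2, -⟩ := exists_contMDiffMap_one_nhds_of_subset_interior (n := (⊤ : ℕ∞))
    (modelWithCornersSelf ℝ V2) hK.isClosed h1
  have hs : tsupport χ ⊆ t := by
    refine closure_minimal ?_ ht.isClosed
    intro x hx
    by_contra hxt
    exact hx (c2 x hxt)
  refine ⟨χ, χ.contMDiff.contDiff, ht.of_isClosed_subset (isClosed_tsupport _) hs, hs.trans h2, ?_⟩
  intro x hx
  exact c1.filter_mono (nhds_le_nhdsSet hx)

lemma cut_C1 {K : Set V2} (hK : IsCompact K) {U : Set V2} (hU : IsOpen U) (hKU : K ⊆ U) {f : V2 → ℝ}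
    (hf : ContDiffOn ℝ 1 f U) :
    ∃ F : V2 → ℝ, ContDiff ℝ 1 F ∧ HasCompactSupport F ∧ ∀ x ∈ K, F =ᶠ[𝓝 x] f := by
  obtain ⟨χ, h1, h2, h3, h4⟩ := cutoff hK hU hKU
  refine ⟨fun x => χ x * f x, ?_, h2.mul_right, ?_⟩
  · rw [contDiff_iff_contDiffAt]
    intro x
    by_cases hx : x ∈ U
    · exact ((h1.of_le (natle 1)).contDiffAt).mul (hf.contDiffAt (hU.mem_nhds hx))
    · have : ∀ᶠ y in 𝓝 x, y ∉ tsupport χ :=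
        (isClosed_tsupport χ).isOpen_compl.mem_nhds (fun h => hx (h3 h))
      refine (contDiffAt_const (c := (0:ℝ))).congr_of_eventuallyEq ?_
      filter_upwards [this] with y hy
      simp [image_eq_zero_of_notMem_tsupport hy]
  · intro x hx
    filter_upwards [h4 x hx] with y hy
    simp [hy]

lemma cpt_SB {f : V2 → ℝ} (hf : Sm f) (hc : HasCompactSupport f) (n : ℕ) : ∃ c, SB n c 1 f := by
  have : ∀ j : ℕ, ∃ c, ∀ x, ‖iteratedFDeriv ℝ j f x‖ ≤ c := fun j =>
    (hc.iteratedFDeriv (𝕜 := ℝ) j).exists_bound_of_continuous (hf.continuous_iteratedFDeriv (natle j))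
  choose c hcc using this
  refine ⟨∑ j ∈ Finset.range (n + 1), c j, hf, fun j hj x => ?_⟩
  rw [one_pow, mul_one]
  refine (hcc j x).trans ?_
  refine Finset.single_le_sum (f := c) (fun i _ => (norm_nonneg _).trans (hcc i x))
    (Finset.mem_range.2 (by omega))

lemma unif {R : ℝ} {f : V2 → ℝ} (hf : Continuous f) {δ : ℝ} (hδ : 0 < δ) :
    ∃ l0 > 0, ∀ l, 0 < l → l ≤ l0 → ∀ x, ‖x‖ ≤ R → ∀ z, ‖z - x‖ ≤ l → |f z - f x| ≤ δ := by
  have := (isCompact_closedBall (0 : V2) (R + 1)).uniformContinuousOn_of_continuous hf.continuousOn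
  rw [Metric.uniformContinuousOn_iff_le] at this
  obtain ⟨l, hl, h⟩ := this δ hδ
  refine ⟨min l 1, by positivity, fun l' hl0 hl' x hx z hz => ?_⟩
  have h1 := hz.trans (hl'.trans (min_le_left _ _))
  have h2 := hz.trans (hl'.trans (min_le_right _ _))
  have h3 : ‖z‖ ≤ R + 1 := by
    calc ‖z‖ = ‖x + (z - x)‖ := by congr 1; abel
      _ ≤ _ := norm_add_le _ _
      _ ≤ _ := by linarith
  have := h z (by simpa using h3) x (by simp; linarith) (by rw [dist_eq_norm]; exact h1)
  rwa [Real.dist_eq] at this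

lemma approx_C0 {R : ℝ} {f : V2 → ℝ} (hf : Continuous f) {δ : ℝ} (hδ : 0 < δ) :
    ∃ g : V2 → ℝ, Sm g ∧ HasCompactSupport g ∧ ∀ x, ‖x‖ ≤ R → |g x - f x| ≤ δ := by
  obtain ⟨l, hl, h⟩ := unif (R := R) hf hδ
  obtain ⟨χ, h1, h2, -, h4⟩ := cutoff (isCompact_closedBall (0 : V2) R) isOpen_univ (Set.subset_univ _)
  refine ⟨fun x => χ x * moll l f x, h1.mul (moll_sm hl hf), h2.mul_right, fun x hx => ?_⟩
  have := (h4 x (by simpa using hx)).self_of_nhds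
  simp only [this, one_mul]
  exact moll_close hl hf (h l hl le_rfl x hx)

lemma pd_congr {f g : V2 → ℝ} {x : V2} (h : f =ᶠ[𝓝 x] g) (i : Fin 2) : pd i f x = pd i g x := by
  unfold pd; rw [h.fderiv_eq]

lemma approx_C1 {R : ℝ} {f : V2 → ℝ} (hf : ContDiff ℝ 1 f) {δ : ℝ} (hδ : 0 < δ) :
    ∃ g : V2 → ℝ, Sm g ∧ HasCompactSupport g ∧ ∀ x, ‖x‖ ≤ R → |g x - f x| ≤ δ ∧
      ∀ i, |pd i g x - pd i f x| ≤ δ := by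
  have hc : ∀ i, Continuous (pd i f) := fun i =>
    (hf.continuous_fderiv (by norm_num)).clm_apply continuous_const
  obtain ⟨l, hl, h⟩ := unif (R := R) hf.continuous hδ
  obtain ⟨l', hl', h'⟩ := unif (R := R) (hc 0) hδ
  obtain ⟨l'', hl'', h''⟩ := unif (R := R) (hc 1) hδ
  set m := min l (min l' l'') with hm
  have hm0 : 0 < m := by positivity
  have m1 : m ≤ l := min_le_left _ _
  have m2 : m ≤ l' := (min_le_right _ _).trans (min_le_left _ _)
  have m3 : m ≤ l'' := (min_le_right _ _).trans (min_le_right _ _)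
  obtain ⟨χ, h1, h2, -, h4⟩ := cutoff (isCompact_closedBall (0 : V2) R) isOpen_univ (Set.subset_univ _)
  refine ⟨fun x => χ x * moll m f x, h1.mul (moll_sm hm0 hf.continuous), h2.mul_right,
    fun x hx => ⟨?_, fun i => ?_⟩⟩
  · have := (h4 x (by simpa using hx)).self_of_nhds
    simp only [this, one_mul]
    exact moll_close hm0 hf.continuous (h m hm0 m1 x hx)
  · have he : (fun x => χ x * moll m f x) =ᶠ[𝓝 x] moll m f := by
      filter_upwards [h4 x (by simpa using hx)] with y hy
      simp [hy]
    rw [pd_congr he, moll_pd m hf]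
    refine moll_close hm0 (hc i) ?_
    fin_cases i
    · exact h' m hm0 m2 x hx
    · exact h'' m hm0 m3 x hx

def hat (t : ℝ) : ℝ := max 0 (1 - |t|)

lemma hat_nonneg (t : ℝ) : 0 ≤ hat t := le_max_left _ _

lemma hat_cont : Continuous hat := by unfold hat; fun_prop

lemma hat_sum {M : ℕ} {t : ℝ} (h0 : 0 ≤ t) (hM : t + 1 < M) (g : ℕ → ℝ) :
    ∃ (k : ℕ) (f : ℝ), 0 ≤ f ∧ f ≤ 1 ∧ t = k + f ∧
      ∑ j ∈ Finset.range M, hat (t - j) * g j = (1 - f) * g k + f * g (k + 1) := by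
  have h1 := Nat.floor_le h0
  have h2 := Nat.lt_floor_add_one t
  set k := ⌊t⌋₊ with hk
  refine ⟨k, t - k, by linarith, by linarith, by ring, ?_⟩
  have hkM : k + 1 < M := by
    have : ((k + 1 : ℕ) : ℝ) < M := by push_cast; linarith
    exact_mod_cast this
  rw [Finset.sum_eq_add_of_mem k (k + 1) (Finset.mem_range.2 (by omega)) (Finset.mem_range.2 hkM)
    (by omega)]
  · congr 2
    · unfold hat
      rw [abs_of_nonneg (by linarith), max_eq_right (by linarith)]
    · unfold hat
      push_cast
      rw [abs_of_nonpos (by linarith), max_eq_right (by linarith)]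
      ring
  · rintro j - ⟨hj1, hj2⟩
    have : hat (t - j) = 0 := by
      unfold hat
      refine max_eq_left ?_
      rcases lt_or_gt_of_ne hj1 with h | h
      · have : (j : ℝ) + 1 ≤ k := by exact_mod_cast h
        have := le_abs_self (t - j)
        linarith
      · have : k + 2 ≤ j := by omega
        have : (k : ℝ) + 2 ≤ j := by exact_mod_cast this
        have := neg_le_abs (t - j)
        linarith
    rw [this, zero_mul]

lemma decomp {K : Set V2} (D : Fin 2 → Fin 2 → V2 → ℝ) (hD : ∀ i j, Continuous (D i j))
    (hs : ∀ i j, D i j = D j i) {c P : ℝ} (hc : 0 < c)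
    (hP : ∀ i j, ∀ x ∈ K, |D i j x| ≤ P)
    (hq : ∀ x ∈ K, ∀ a b : ℝ, c * (a ^ 2 + b ^ 2) ≤ a ^ 2 * D 0 0 x + 2 * (a * b) * D 0 1 x + b ^ 2 * D 1 1 x) :
    ∃ (n : ℕ) (ξ : ℕ → V2) (f : ℕ → V2 → ℝ), (∀ k, Continuous (f k)) ∧
      ∀ x ∈ K, ∀ i j, ∑ k ∈ Finset.range n, f k x ^ 2 / 2 * (ξ k i * ξ k j) = D i j x := by
  by_cases hKe : K.Nonempty
  swap
  · refine ⟨0, fun _ => 0, fun _ _ => 0, fun _ => continuous_const, fun x hx => ?_⟩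
    exact absurd ⟨x, hx⟩ hKe
  have hP0 : 0 ≤ P := by
    obtain ⟨x, hx⟩ := hKe
    exact (abs_nonneg _).trans (hP 0 0 x hx)
  set h := c / (c + P) with hh
  have h0 : 0 < h := by positivity
  have h1 : h ≤ 1 := by rw [hh, div_le_one (by positivity)]; linarith
  have h2 : P * h ≤ c := by
    rw [hh, ← mul_div_assoc, div_le_iff₀ (by positivity)]; nlinarith
  obtain ⟨N, hN⟩ := exists_nat_ge (P / c / h)
  set M := 2 * N + 2 with hM
  set s : ℕ → ℝ := fun k => h * (k - N) with hsdef
  set T : V2 → ℝ := fun x => D 0 1 x / max (D 0 0 x) c / h + N with hT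
  have hmax : ∀ x, max (D 0 0 x) c ≠ 0 := fun x => (hc.trans_le (le_max_right _ _)).ne'
  have hTc : Continuous T := by
    refine Continuous.add (Continuous.div_const ?_ _) continuous_const
    exact (hD 0 1).div ((hD 0 0).max continuous_const) hmax
  set a : ℕ → V2 → ℝ := fun k x => if k < M then D 0 0 x * hat (T x - k) else
    D 1 1 x - D 0 0 x * ∑ j ∈ Finset.range M, hat (T x - j) * s j ^ 2 with ha
  have hhc : ∀ k : ℕ, Continuous fun x => hat (T x - k) := fun k =>
    hat_cont.comp (hTc.sub continuous_const)
  have hac : ∀ k, Continuous (a k) := by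
    intro k
    simp only [ha]
    by_cases hk : k < M
    · simp only [hk, if_true]
      exact (hD 0 0).mul (hhc k)
    · simp only [hk, if_false]
      exact (hD 1 1).sub ((hD 0 0).mul (continuous_finsetSum _ fun j _ =>
        (hhc j).mul continuous_const))
  refine ⟨M + 1, fun k => if k < M then ![1, s k] else ![0, 1],
    fun k x => Real.sqrt (2 * max (a k x) 0), ?_, ?_⟩
  · intro k
    exact Real.continuous_sqrt.comp (continuous_const.mul ((hac k).max continuous_const))
  intro x hx
  set p := D 0 0 x with hp
  set q := D 0 1 x with hqq
  set r := D 1 1 x with hr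
  have hpc : c ≤ p := by have := hq x hx 1 0; simp at this; linarith
  have p0 : 0 < p := by linarith
  have hpP : p ≤ P := (le_abs_self _).trans (hP 0 0 x hx)
  have hqP : |q| ≤ P := hP 0 1 x hx
  have hTx : T x = q / p / h + N := by simp only [hT]; rw [max_eq_left hpc]
  have hqp : |q / p / h| ≤ N := by
    rw [abs_div, abs_div, abs_of_pos p0, abs_of_pos h0]
    refine le_trans ?_ hN
    gcongr
  have hT0 : 0 ≤ T x := by rw [hTx]; linarith [(abs_le.1 hqp).1]
  have hT1 : T x + 1 < M := by
    rw [hTx, hM]; push_cast; linarith [(abs_le.1 hqp).2]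
  have hrq : c ≤ r - q ^ 2 / p := by
    have := hq x hx (-q / p) 1
    rw [← hp, ← hqq, ← hr] at this
    have e1 : (-q / p) ^ 2 * p + 2 * (-q / p * 1) * q + 1 ^ 2 * r = r - q ^ 2 / p := by
      field_simp; ring
    rw [e1] at this
    have : 0 ≤ c * (-q / p) ^ 2 := by positivity
    nlinarith
  -- the three sums
  have S0 : ∑ j ∈ Finset.range M, hat (T x - j) = 1 := by
    obtain ⟨k, f, -, -, -, e⟩ := hat_sum hT0 hT1 (fun _ => 1)
    simpa using e
  have S1 : ∑ j ∈ Finset.range M, hat (T x - j) * s j = q / p := by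
    obtain ⟨k, f, -, -, e1, e⟩ := hat_sum hT0 hT1 s
    rw [e]
    simp only [hsdef]
    push_cast
    have : q / p / h = k + f - N := by rw [← e1, hTx]; ring
    have : q / p = (k + f - N) * h := by rw [← this]; field_simp
    rw [this]; ring
  have S2 : ∑ j ∈ Finset.range M, hat (T x - j) * s j ^ 2 ≤ (q / p) ^ 2 + h ^ 2 := by
    obtain ⟨k, f, f0, f1, e1, e⟩ := hat_sum hT0 hT1 (fun j => s j ^ 2)
    rw [e]
    simp only [hsdef]
    push_cast
    have : q / p / h = k + f - N := by rw [← e1, hTx]; ring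
    have : q / p = (k + f - N) * h := by rw [← this]; field_simp
    rw [this]
    have : f * (1 - f) ≤ 1 := by nlinarith
    have := mul_le_mul_of_nonneg_right this (sq_nonneg h)
    nlinarith
  have hapos : ∀ k, 0 ≤ a k x := by
    intro k
    simp only [ha]
    split_ifs
    · exact mul_nonneg p0.le (hat_nonneg _)
    · have h3 := mul_le_mul_of_nonneg_left S2 p0.le
      have h4 : p * ((q / p) ^ 2 + h ^ 2) = q ^ 2 / p + p * h ^ 2 := by field_simp
      have h5 : p * h ^ 2 ≤ c := by
        calc p * h ^ 2 ≤ P * h ^ 2 := by gcongr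
          _ = (P * h) * h := by ring
          _ ≤ c * 1 := by gcongr
          _ = c := mul_one c
      linarith
  have hsq : ∀ k, Real.sqrt (2 * max (a k x) 0) ^ 2 / 2 = a k x := by
    intro k
    rw [max_eq_left (hapos k), Real.sq_sqrt (by have := hapos k; linarith)]; ring
  intro i j
  simp only [hsq]
  rw [Finset.sum_range_succ]
  have e0 : ∀ g : ℕ → ℝ, ∑ k ∈ Finset.range M, a k x * g k = p * ∑ k ∈ Finset.range M, hat (T x - k) * g k := by
    intro g
    rw [Finset.mul_sum]
    refine Finset.sum_congr rfl fun k hk => ?_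
    simp only [ha, Finset.mem_range.1 hk, if_true]
    ring
  have e1 : ∑ k ∈ Finset.range M, a k x * ((if k < M then ![1, s k] else ![0, 1] : V2) i *
      (if k < M then ![1, s k] else ![0, 1] : V2) j) =
      ∑ k ∈ Finset.range M, a k x * ((![1, s k] : V2) i * (![1, s k] : V2) j) := by
    refine Finset.sum_congr rfl fun k hk => ?_
    simp only [Finset.mem_range.1 hk, if_true]
  rw [e1, e0]
  have eM : a M x = r - p * ∑ j ∈ Finset.range M, hat (T x - j) * s j ^ 2 := by simp [ha, hr, hp]
  rw [eM]
  have hs10 : D 1 0 x = q := by rw [hs 1 0]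
  fin_cases i <;> fin_cases j
  · simp [S0, hp]
  · simp [S1, hqq]; field_simp
  · simp [S1, hs10]; field_simp
  · simp [← pow_two]; rfl

def Reg (v : V2 → ℝ) (w : Fin 2 → V2 → ℝ) : Prop :=
  Sm v ∧ (∀ j, Sm (w j)) ∧ ∃ c, (∀ i, SB 2 c 1 (pd i v)) ∧ (∀ i j x, |pd i (w j) x| ≤ c) ∧
    ∀ i j x y, |pd i (w j) x - pd i (w j) y| ≤ c * ‖x - y‖

lemma multi1 {v b : V2 → ℝ} {w : Fin 2 → V2 → ℝ} (hvw : Reg v w) (ξ : V2) (hb : ∃ c, SB 3 c 1 b)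
    {δ : ℝ} (hδ : 0 < δ) : ∃ (v' : V2 → ℝ) (w' : Fin 2 → V2 → ℝ), Reg v' w' ∧
      (∀ x, |v' x - v x| ≤ δ) ∧ (∀ j x, |w' j x - w j x| ≤ δ) ∧
      ∀ i j x, |Df v' w' i j x - Df v w i j x - b x ^ 2 / 2 * (ξ i * ξ j)| ≤ δ := by
  obtain ⟨hv, hw, c, h1, h2, h3⟩ := hvw
  obtain ⟨cb, hb⟩ := hb
  have c0 : 0 ≤ c := (h1 0).nonneg
  have cb0 : 0 ≤ cb := hb.nonneg
  set e := c + cb with he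
  have e0 : 0 ≤ e := by positivity
  set X := 1 + |ξ 0| + |ξ 1| with hX
  have a0 := abs_nonneg (ξ 0)
  have a1 := abs_nonneg (ξ 1)
  have X1 : 1 ≤ X := by linarith
  have hξ : ∀ i, |ξ i| ≤ X := by
    intro i; fin_cases i
    · change |ξ 0| ≤ X; linarith
    · change |ξ 1| ≤ X; linarith
  obtain ⟨-, -, hc⟩ := cC_ge X1
  set k := 1 + cC X with hk
  have k0 : 0 < k := by linarith
  set lam := 1 + k * (e + e ^ 2) / δ with hlam
  have l1 : 1 ≤ lam := by rw [hlam, le_add_iff_nonneg_right]; positivity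
  have l0 : 0 < lam := by linarith
  have hlδ : δ * lam = δ + k * (e + e ^ 2) := by rw [hlam]; field_simp
  obtain ⟨v', w', hv', hw', b1, b2, b3, b4, b5, b6, b7, b8⟩ :=
    corr' X1 hv hw hξ one_pos l1 (le_refl e) (hb.mono (by linarith) e0 zero_le_one le_rfl)
      (fun i => (h1 i).mono (by linarith) e0 zero_le_one le_rfl)
      (fun i j => by
        have := ((h1 j).pd i)
        rw [mul_one] at this
        exact this.mono (by linarith) (by positivity) zero_le_one le_rfl)
  rw [← hk] at b1 b2 b3 b4 b5 b6 b7 b8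
  have ke : 0 ≤ k * e := by positivity
  have ke2 : 0 ≤ k * e ^ 2 := by positivity
  refine ⟨v', w', ⟨hv', hw', k * e * lam ^ 2 + (c + k * (e * e)) + (c + k * (e * e) * lam),
    fun i => ?_, fun i j x => ?_, fun i j x y => ?_⟩, fun x => (b3 x).trans ?_, fun j x => (b4 j x).trans ?_,
    fun i j x => (b8 i j x).trans ?_⟩
  · refine ⟨(b1 i).1, fun m hm x => ((b1 i).2 m hm x).trans ?_⟩
    rw [one_pow, mul_one]
    have : lam ^ m ≤ lam ^ 2 := pow_le_pow_right₀ l1 hm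
    have h' : k * e * lam ^ m ≤ k * e * lam ^ 2 := by gcongr
    have : 0 ≤ (c + k * (e * e)) + (c + k * (e * e) * lam) := by positivity
    linarith
  · have := b6 i j x
    have h' := h2 i j x
    have h'' : |pd i (w' j) x| ≤ |pd i (w' j) x - pd i (w j) x| + |pd i (w j) x| := by
      have := abs_add_le (pd i (w' j) x - pd i (w j) x) (pd i (w j) x)
      simpa using this
    have : 0 ≤ k * e * lam ^ 2 + (c + k * (e * e) * lam) := by positivity
    linarith
  · have := b7 i j x y
    have h' := h3 i j x y
    have e1 : pd i (w' j) x - pd i (w' j) y = ((pd i (w' j) x - pd i (w j) x) -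
      (pd i (w' j) y - pd i (w j) y)) + (pd i (w j) x - pd i (w j) y) := by ring
    rw [e1]
    refine (abs_add_le _ _).trans ((add_le_add this h').trans ?_)
    rw [← add_mul]
    refine mul_le_mul_of_nonneg_right ?_ (norm_nonneg _)
    have : 0 ≤ k * e * lam ^ 2 + (c + k * (e * e)) := by positivity
    linarith
  · rw [div_le_iff₀ l0, hlδ]; nlinarith
  · rw [div_le_iff₀ l0, hlδ]; nlinarith
  · rw [mul_one_div, div_le_iff₀ l0, hlδ]; nlinarith

lemma multi (ξ : ℕ → V2) (b : ℕ → V2 → ℝ) (hb : ∀ k, ∃ c, SB 3 c 1 (b k)) {v : V2 → ℝ}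
    {w : Fin 2 → V2 → ℝ} (hvw : Reg v w) (n : ℕ) : ∀ δ : ℝ, 0 < δ →
    ∃ (v' : V2 → ℝ) (w' : Fin 2 → V2 → ℝ), Reg v' w' ∧
      (∀ x, |v' x - v x| ≤ δ) ∧ (∀ j x, |w' j x - w j x| ≤ δ) ∧
      ∀ i j x, |Df v' w' i j x - Df v w i j x
        - ∑ k ∈ Finset.range n, b k x ^ 2 / 2 * (ξ k i * ξ k j)| ≤ δ := by
  induction n with
  | zero =>
    intro δ hδ
    exact ⟨v, w, hvw, by simp [hδ.le], by simp [hδ.le], by simp [hδ.le]⟩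
  | succ n ih =>
    intro δ hδ
    obtain ⟨v1, w1, r1, a1, a2, a3⟩ := ih (δ / 2) (by positivity)
    obtain ⟨v2, w2, r2, b1, b2, b3⟩ := multi1 r1 (ξ n) (hb n) (half_pos hδ)
    refine ⟨v2, w2, r2, fun x => ?_, fun j x => ?_, fun i j x => ?_⟩
    · have := abs_add_le (v2 x - v1 x) (v1 x - v x)
      rw [sub_add_sub_cancel] at this
      linarith [a1 x, b1 x]
    · have := abs_add_le (w2 j x - w1 j x) (w1 j x - w j x)
      rw [sub_add_sub_cancel] at this
      linarith [a2 j x, b2 j x]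
    · rw [Finset.sum_range_succ]
      have := abs_add_le (Df v2 w2 i j x - Df v1 w1 i j x - b n x ^ 2 / 2 * (ξ n i * ξ n j))
        (Df v1 w1 i j x - Df v w i j x - ∑ k ∈ Finset.range n, b k x ^ 2 / 2 * (ξ k i * ξ k j))
      refine le_trans (le_of_eq ?_) (this.trans (by linarith [a3 i j x, b3 i j x]))
      congr 1; ring

lemma Reg.cont {v : V2 → ℝ} {w : Fin 2 → V2 → ℝ} (h : Reg v w) (i j : Fin 2) :
    Continuous (Df v w i j) :=
  (((h.2.1 j).pd i).cont.add ((h.2.1 i).pd j).cont).add ((h.1.pd i).cont.mul (h.1.pd j).cont)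

lemma Df_symm (v : V2 → ℝ) (w : Fin 2 → V2 → ℝ) (i j : Fin 2) : Df v w i j = Df v w j i := by
  funext x; simp only [Df]; ring

lemma Reg.lip {v : V2 → ℝ} {w : Fin 2 → V2 → ℝ} (h : Reg v w) :
    ∃ L, 0 ≤ L ∧ ∀ i j x y, |Df v w i j x - Df v w i j y| ≤ L * ‖x - y‖ := by
  obtain ⟨hv, hw, c, h1, h2, h3⟩ := h
  have c0 : 0 ≤ c := (h1 0).nonneg
  refine ⟨2 * c + 2 * (c * c), by positivity, fun i j x y => ?_⟩
  have l : ∀ i, |pd i v x - pd i v y| ≤ c * ‖x - y‖ := fun i => by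
    have := (h1 i).lip x y
    rwa [mul_one] at this
  have e : Df v w i j x - Df v w i j y = (pd i (w j) x - pd i (w j) y) + (pd j (w i) x - pd j (w i) y)
    + (pd i v x * (pd j v x - pd j v y) + (pd i v x - pd i v y) * pd j v y) := by
    simp only [Df]; ring
  have n0 := norm_nonneg (x - y)
  have p1 : |pd i v x * (pd j v x - pd j v y)| ≤ c * (c * ‖x - y‖) := by
    rw [abs_mul]
    exact mul_le_mul ((h1 i).abs_le x) (l j) (abs_nonneg _) c0
  have p2 : |(pd i v x - pd i v y) * pd j v y| ≤ (c * ‖x - y‖) * c := by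
    rw [abs_mul]
    exact mul_le_mul (l i) ((h1 j).abs_le y) (abs_nonneg _) (by positivity)
  rw [e]
  refine (abs_add_le _ _).trans ((add_le_add (abs_add_le _ _) (abs_add_le _ _)).trans ?_)
  linarith [h3 i j x y, h3 j i x y]

lemma reg_of_cpt {v : V2 → ℝ} {w : Fin 2 → V2 → ℝ} (hv : Sm v) (hvc : HasCompactSupport v)
    (hw : ∀ j, Sm (w j)) (hwc : ∀ j, HasCompactSupport (w j)) : Reg v w := by
  obtain ⟨c, hc⟩ := cpt_SB hv hvc 3
  have : ∀ j, ∃ d, SB 3 d 1 (w j) := fun j => cpt_SB (hw j) (hwc j) 3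
  choose d hd using this
  have c0 := hc.nonneg
  have d0 := (hd 0).nonneg
  have d1 := (hd 1).nonneg
  have hdd : ∀ j, d j ≤ c + d 0 + d 1 := by
    intro j; fin_cases j
    · change d 0 ≤ _; linarith
    · change d 1 ≤ _; linarith
  refine ⟨hv, hw, c + d 0 + d 1, fun i => ?_, fun i j x => ?_, fun i j x y => ?_⟩
  · have := hc.pd i
    rw [mul_one] at this
    exact this.mono (by linarith) (by positivity) zero_le_one le_rfl
  · have := ((hd j).pd i).abs_le x
    rw [mul_one] at this
    exact this.trans (hdd j)
  · have := ((hd j).pd i).lip x y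
    rw [mul_one, mul_one] at this
    exact this.trans (mul_le_mul_of_nonneg_right (hdd j) (norm_nonneg _))

lemma approx_sq {R : ℝ} {f : V2 → ℝ} (hf : Continuous f) {τ : ℝ} (hτ : 0 < τ) :
    ∃ b : V2 → ℝ, (∃ c, SB 3 c 1 b) ∧ ∀ x, ‖x‖ ≤ R → |f x ^ 2 - b x ^ 2| ≤ τ := by
  obtain ⟨F, hF⟩ := (isCompact_closedBall (0 : V2) R).exists_bound_of_continuousOn hf.continuousOn
  set δ := min 1 (τ / (2 * |F| + 1)) with hδ
  have δ0 : 0 < δ := by positivity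
  obtain ⟨b, h1, h2, h3⟩ := approx_C0 (R := R) hf δ0
  refine ⟨b, cpt_SB h1 h2 3, fun x hx => ?_⟩
  have g1 := h3 x hx
  have g2 : |f x| ≤ |F| := (hF x (by simpa using hx)).trans (le_abs_self _)
  have g3 : |f x + b x| ≤ 2 * |F| + 1 := by
    have e : f x + b x = (b x - f x) + (f x + f x) := by ring
    rw [e]
    refine (abs_add_le _ _).trans ?_
    have := abs_add_le (f x) (f x)
    linarith [min_le_left 1 (τ / (2 * |F| + 1))]
  have e : f x ^ 2 - b x ^ 2 = -((b x - f x) * (f x + b x)) := by ring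
  rw [e, abs_neg, abs_mul]
  have : δ * (2 * |F| + 1) ≤ τ := by
    have := min_le_right 1 (τ / (2 * |F| + 1))
    rwa [← hδ, le_div_iff₀ (by positivity)] at this
  exact (mul_le_mul g1 g3 (abs_nonneg _) δ0.le).trans this

lemma initial_step {Ω : Set V2} {R : ℝ} (hR : ∀ x ∈ Ω, ‖x‖ ≤ R) {v : V2 → ℝ} {w : Fin 2 → V2 → ℝ}
    (hv : ContDiff ℝ 1 v) (hvc : HasCompactSupport v) (hw : ∀ j, ContDiff ℝ 1 (w j))
    {A : Fin 2 → Fin 2 → V2 → ℝ} (hA : ∀ i j, Continuous (A i j)) (hAs : ∀ i j, A i j = A j i)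
    {BA : ℝ} (hAB : ∀ i j x, |A i j x| ≤ BA) {c : ℝ} (hc : 0 < c)
    (hq : ∀ x ∈ Ω, ∀ a b : ℝ, c * (a ^ 2 + b ^ 2) ≤ a ^ 2 * (A 0 0 x - Df v w 0 0 x)
      + 2 * (a * b) * (A 0 1 x - Df v w 0 1 x) + b ^ 2 * (A 1 1 x - Df v w 1 1 x))
    {η : ℝ} (hη : 0 < η) :
    ∃ (v' : V2 → ℝ) (w' : Fin 2 → V2 → ℝ), Reg v' w' ∧ (∀ x ∈ Ω, |v' x - v x| ≤ η) ∧
      (∀ j, ∀ x ∈ Ω, |w' j x - w j x| ≤ η) ∧ ∀ i j, ∀ x ∈ Ω, |A i j x - Df v' w' i j x| ≤ η := by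
  obtain ⟨B, hB⟩ := (hvc.fderiv (𝕜 := ℝ)).exists_bound_of_continuous (hv.continuous_fderiv (by norm_num))
  have B0 : 0 ≤ B := (norm_nonneg _).trans (hB 0)
  have hB' : ∀ i x, |pd i v x| ≤ B := by
    intro i x
    have := (fderiv ℝ v x).le_opNorm (Pi.single i 1)
    rw [norm_single, mul_one] at this
    exact this.trans (hB x)
  set δ := min 1 (min (η / 2) (c / 4 / (3 + 2 * B))) with hδ
  have δ0 : 0 < δ := by positivity
  have d1 : δ ≤ 1 := min_le_left _ _
  have d2 : δ ≤ η / 2 := (min_le_right _ _).trans (min_le_left _ _)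
  have d3 : δ * (3 + 2 * B) ≤ c / 4 := by
    have : δ ≤ c / 4 / (3 + 2 * B) := (min_le_right _ _).trans (min_le_right _ _)
    rwa [le_div_iff₀ (by positivity)] at this
  obtain ⟨v1, s1, k1, a1⟩ := approx_C1 (R := R) hv δ0
  have : ∀ j, ∃ g : V2 → ℝ, Sm g ∧ HasCompactSupport g ∧ ∀ x, ‖x‖ ≤ R → |g x - w j x| ≤ δ ∧
      ∀ i, |pd i g x - pd i (w j) x| ≤ δ := fun j => approx_C1 (R := R) (hw j) δ0
  choose w1 s2 k2 a2 using this
  have r1 : Reg v1 w1 := reg_of_cpt s1 k1 s2 k2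
  have hdiff : ∀ i j, ∀ x ∈ Ω, |Df v1 w1 i j x - Df v w i j x| ≤ c / 4 := by
    intro i j x hx
    have q1 := (a1 x (hR x hx)).2 i
    have q2 := (a1 x (hR x hx)).2 j
    have q3 := (a2 j x (hR x hx)).2 i
    have q4 := (a2 i x (hR x hx)).2 j
    have e : Df v1 w1 i j x - Df v w i j x = (pd i (w1 j) x - pd i (w j) x) +
      (pd j (w1 i) x - pd j (w i) x) + ((pd i v1 x - pd i v x) * (pd j v1 x - pd j v x) +
        ((pd i v1 x - pd i v x) * pd j v x + pd i v x * (pd j v1 x - pd j v x))) := by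
      simp only [Df]; ring
    have p1 : |(pd i v1 x - pd i v x) * (pd j v1 x - pd j v x)| ≤ δ * 1 := by
      rw [abs_mul]; exact mul_le_mul q1 (q2.trans d1) (abs_nonneg _) δ0.le
    have p2 : |(pd i v1 x - pd i v x) * pd j v x| ≤ δ * B := by
      rw [abs_mul]; exact mul_le_mul q1 (hB' j x) (abs_nonneg _) δ0.le
    have p3 : |pd i v x * (pd j v1 x - pd j v x)| ≤ B * δ := by
      rw [abs_mul]; exact mul_le_mul (hB' i x) q2 (abs_nonneg _) B0
    rw [e]
    refine (abs_add_le _ _).trans ((add_le_add (abs_add_le _ _) ((abs_add_le _ _).trans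
      (add_le_add le_rfl (abs_add_le _ _)))).trans ?_)
    linarith
  obtain ⟨-, -, c1, f1, f2, f3⟩ := id r1
  have c10 : 0 ≤ c1 := (f1 0).nonneg
  have hDb : ∀ i j x, |Df v1 w1 i j x| ≤ 2 * c1 + c1 * c1 := by
    intro i j x
    simp only [Df]
    refine (abs_add_le _ _).trans ((add_le_add (abs_add_le _ _) le_rfl).trans ?_)
    rw [abs_mul]
    have := mul_le_mul ((f1 i).abs_le x) ((f1 j).abs_le x) (abs_nonneg _) c10
    linarith [f2 i j x, f2 j i x]
  obtain ⟨n, ξ, f, fc, hf⟩ := decomp (K := Ω) (fun i j x => A i j x - Df v1 w1 i j x)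
    (fun i j => (hA i j).sub (r1.cont i j))
    (fun i j => by funext x; rw [hAs i j, Df_symm v1 w1 i j]) (half_pos hc)
    (P := BA + (2 * c1 + c1 * c1))
    (fun i j x _ => (abs_sub _ _).trans (add_le_add (hAB i j x) (hDb i j x)))
    (by
      intro x hx a b
      have g0 := hq x hx a b
      have g1 := hdiff 0 0 x hx
      have g2 := hdiff 0 1 x hx
      have g3 := hdiff 1 1 x hx
      rw [abs_le] at g1 g2 g3
      have m1 := mul_le_mul_of_nonneg_left g1.2 (sq_nonneg a)
      have m3 := mul_le_mul_of_nonneg_left g3.2 (sq_nonneg b)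
      have m2 : 2 * (a * b) * (Df v1 w1 0 1 x - Df v w 0 1 x) ≤ c / 4 * (a ^ 2 + b ^ 2) := by
        have t1 := mul_nonneg (sq_nonneg (a + b)) (by linarith [g2.2] : 0 ≤ c / 4 - (Df v1 w1 0 1 x - Df v w 0 1 x))
        have t2 := mul_nonneg (sq_nonneg (a - b)) (by linarith [g2.1] : 0 ≤ c / 4 + (Df v1 w1 0 1 x - Df v w 0 1 x))
        nlinarith
      nlinarith)
  -- smooth approximations of the amplitudes
  set X := ∑ k ∈ Finset.range n, (|ξ k 0| + |ξ k 1|) ^ 2 with hX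
  have X0 : 0 ≤ X := Finset.sum_nonneg fun k _ => sq_nonneg _
  set τ := η / (X + 1) with hτ
  have τ0 : 0 < τ := by positivity
  have : ∀ k, ∃ b : V2 → ℝ, (∃ c, SB 3 c 1 b) ∧ ∀ x, ‖x‖ ≤ R → |f k x ^ 2 - b x ^ 2| ≤ τ :=
    fun k => approx_sq (fc k) τ0
  choose b hb hbf using this
  obtain ⟨v2, w2, r2, m1, m2, m3⟩ := multi ξ b hb r1 n (η / 2) (half_pos hη)
  refine ⟨v2, w2, r2, fun x hx => ?_, fun j x hx => ?_, fun i j x hx => ?_⟩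
  · have := abs_add_le (v2 x - v1 x) (v1 x - v x)
    rw [sub_add_sub_cancel] at this
    linarith [m1 x, (a1 x (hR x hx)).1]
  · have := abs_add_le (w2 j x - w1 j x) (w1 j x - w j x)
    rw [sub_add_sub_cancel] at this
    linarith [m2 j x, (a2 j x (hR x hx)).1]
  · have hs : |∑ k ∈ Finset.range n, f k x ^ 2 / 2 * (ξ k i * ξ k j)
        - ∑ k ∈ Finset.range n, b k x ^ 2 / 2 * (ξ k i * ξ k j)| ≤ η / 2 := by
      rw [← Finset.sum_sub_distrib]
      calc _ ≤ ∑ k ∈ Finset.range n, |f k x ^ 2 / 2 * (ξ k i * ξ k j) - b k x ^ 2 / 2 * (ξ k i * ξ k j)| :=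
            Finset.abs_sum_le_sum_abs _ _
        _ ≤ ∑ k ∈ Finset.range n, τ / 2 * (|ξ k 0| + |ξ k 1|) ^ 2 := by
            refine Finset.sum_le_sum fun k _ => ?_
            have e : f k x ^ 2 / 2 * (ξ k i * ξ k j) - b k x ^ 2 / 2 * (ξ k i * ξ k j)
              = (f k x ^ 2 - b k x ^ 2) / 2 * (ξ k i * ξ k j) := by ring
            have hi : ∀ i, |ξ k i| ≤ |ξ k 0| + |ξ k 1| := by
              intro i
              have a0 := abs_nonneg (ξ k 0)
              have a1 := abs_nonneg (ξ k 1)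
              fin_cases i
              · change |ξ k 0| ≤ _; linarith
              · change |ξ k 1| ≤ _; linarith
            rw [e, abs_mul, abs_mul, abs_div, abs_of_pos (zero_lt_two' ℝ), pow_two (|ξ k 0| + |ξ k 1|)]
            have h1 := hbf k x (hR x hx)
            have h2 := hi i
            have h3 := hi j
            gcongr
        _ = τ / 2 * X := by rw [hX, Finset.mul_sum]
        _ ≤ η / 2 := by
            have : τ * (X + 1) = η := by rw [hτ]; field_simp
            nlinarith
    rw [hf x hx i j] at hs
    have m := m3 i j x
    have e : A i j x - Df v2 w2 i j x = (A i j x - Df v1 w1 i j x -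
      ∑ k ∈ Finset.range n, b k x ^ 2 / 2 * (ξ k i * ξ k j)) - (Df v2 w2 i j x - Df v1 w1 i j x -
      ∑ k ∈ Finset.range n, b k x ^ 2 / 2 * (ξ k i * ξ k j)) := by ring
    rw [e]
    refine (abs_sub _ _).trans ?_
    linarith

lemma core (α β : ℝ) (hβ0 : 0 < β) (hβ1 : β < 1) (hα0 : 0 < α) (hα : α < min (1 / 7 : ℝ) (β / 2))
    {Ω : Set V2} (hne : Ω.Nonempty) {R : ℝ} (hR : ∀ x ∈ Ω, ‖x‖ ≤ R) {v : V2 → ℝ} {w : Fin 2 → V2 → ℝ}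
    (hv : ContDiff ℝ 1 v) (hvc : HasCompactSupport v) (hw : ∀ j, ContDiff ℝ 1 (w j))
    {A : Fin 2 → Fin 2 → V2 → ℝ} (hAs : ∀ i j, A i j = A j i) {H : ℝ}
    (hH : ∀ i j, ∀ x ∈ Ω, ∀ y ∈ Ω, |A i j x - A i j y| ≤ H * ‖x - y‖ ^ β) {c : ℝ} (hc : 0 < c)
    (hq : ∀ x ∈ Ω, ∀ a b : ℝ, c * (a ^ 2 + b ^ 2) ≤ a ^ 2 * (A 0 0 x - Df v w 0 0 x)
      + 2 * (a * b) * (A 0 1 x - Df v w 0 1 x) + b ^ 2 * (A 1 1 x - Df v w 1 1 x))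
    {ε : ℝ} (hε : 0 < ε) :
    ∃ (v' : V2 → ℝ) (w' : Fin 2 → V2 → ℝ), Differentiable ℝ v' ∧ (∀ j, Differentiable ℝ (w' j)) ∧
        (∀ x ∈ Ω, |v' x - v x| ≤ ε) ∧ (∀ j, ∀ x ∈ Ω, |w' j x - w j x| ≤ ε) ∧
        (∃ Hc, ∀ i x y, |pd i v' x - pd i v' y| ≤ Hc * ‖x - y‖ ^ α) ∧
        (∀ j, ∃ Hc, ∀ i x y, |pd i (w' j) x - pd i (w' j) y| ≤ Hc * ‖x - y‖ ^ α) ∧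
        ∀ i j, ∀ x ∈ Ω, Df v' w' i j x = A i j x := by
  obtain ⟨x0, hx0⟩ := id hne
  have R0 : 0 ≤ R := (norm_nonneg _).trans (hR x0 hx0)
  -- make the Hölder constant nonnegative
  wlog hH0 : 0 ≤ H generalizing H
  · refine this (H := |H|) (fun i j x hx y hy => (hH i j x hx y hy).trans ?_) (abs_nonneg _)
    exact mul_le_mul_of_nonneg_right (le_abs_self _) (by positivity)
  -- global extension of `A`
  have hAb : ∀ i j, ∀ x ∈ Ω, |A i j x| ≤ |A 0 0 x0| + |A 0 1 x0| + |A 1 1 x0| + H * (2 * R) ^ β := by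
    intro i j x hx
    have h1 := hH i j x hx x0 hx0
    have h2 : ‖x - x0‖ ≤ 2 * R := (norm_sub_le _ _).trans (by linarith [hR x hx, hR x0 hx0])
    have h3 : H * ‖x - x0‖ ^ β ≤ H * (2 * R) ^ β := by gcongr
    have h4 : |A i j x| ≤ |A i j x - A i j x0| + |A i j x0| := by
      have := abs_add_le (A i j x - A i j x0) (A i j x0)
      simpa using this
    have p0 := abs_nonneg (A 0 0 x0)
    have p1 := abs_nonneg (A 0 1 x0)
    have p2 := abs_nonneg (A 1 1 x0)
    have h5 : |A i j x0| ≤ |A 0 0 x0| + |A 0 1 x0| + |A 1 1 x0| := by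
      fin_cases i <;> fin_cases j
      · change |A 0 0 x0| ≤ _; linarith
      · change |A 0 1 x0| ≤ _; linarith
      · change |A 1 0 x0| ≤ _; rw [hAs 1 0]; linarith
      · change |A 1 1 x0| ≤ _; linarith
    linarith
  set BA := |A 0 0 x0| + |A 0 1 x0| + |A 1 1 x0| + H * (2 * R) ^ β with hBA
  have cont_of : ∀ (g : V2 → ℝ) (H' : ℝ), (∀ x y, |g x - g y| ≤ H' * ‖x - y‖ ^ β) → Continuous g := by
    intro g H' h
    rw [continuous_iff_continuousAt]
    intro y
    rw [ContinuousAt, tendsto_iff_norm_sub_tendsto_zero]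
    have T : Filter.Tendsto (fun x : V2 => H' * ‖x - y‖ ^ β) (𝓝 y) (𝓝 0) := by
      have c1 : Continuous fun x : V2 => H' * ‖x - y‖ ^ β :=
        continuous_const.mul ((continuous_id.sub continuous_const).norm.rpow_const
          (fun _ => Or.inr hβ0.le))
      have := c1.tendsto y
      simpa [Real.zero_rpow hβ0.ne'] using this
    exact squeeze_zero (fun _ => norm_nonneg _) (fun x => h x y) T
  have hext : ∀ i j, ∃ g : V2 → ℝ, (∀ x ∈ Ω, g x = A i j x) ∧
      (∀ x y, |g x - g y| ≤ H * ‖x - y‖ ^ β) ∧ ∀ x, |g x| ≤ BA := fun i j =>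
    mcshane hne (A i j) hH0 hβ0 hβ1.le (hH i j) (hAb i j)
  choose g0 g1 g2 g3 using hext
  set Ae : Fin 2 → Fin 2 → V2 → ℝ := fun i j x => (g0 i j x + g0 j i x) / 2 with hAe
  have Ae1 : ∀ i j, ∀ x ∈ Ω, Ae i j x = A i j x := by
    intro i j x hx
    simp only [hAe, g1 i j x hx, g1 j i x hx, hAs j i]; ring
  have Aec : ∀ i j, Continuous (Ae i j) := fun i j =>
    ((cont_of _ _ (g2 i j)).add (cont_of _ _ (g2 j i))).div_const 2
  have Aes : ∀ i j, Ae i j = Ae j i := by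
    intro i j; funext x; simp only [hAe]; ring
  have AeB : ∀ i j x, |Ae i j x| ≤ BA := by
    intro i j x
    simp only [hAe]
    rw [abs_div, abs_of_pos (zero_lt_two' ℝ), div_le_iff₀ zero_lt_two]
    exact (abs_add_le _ _).trans (by linarith [g3 i j x, g3 j i x])
  -- constants
  obtain ⟨es, C', es0, C'0, hit⟩ := iter α β hβ0 hβ1 hα0 hα
  obtain ⟨e0, he0, he1, he2⟩ : ∃ e0 : ℝ, 0 < e0 ∧ e0 ≤ es ∧ C' * e0 ^ 2 * R ≤ ε / 4 := by
    refine ⟨min es (min 1 (ε / 4 / (C' * (R + 1)))), by positivity, min_le_left _ _, ?_⟩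
    set e := min es (min 1 (ε / 4 / (C' * (R + 1)))) with he
    have e0 : 0 < e := by positivity
    have e1 : e ≤ 1 := (min_le_right _ _).trans (min_le_left _ _)
    have e2 : e ≤ ε / 4 / (C' * (R + 1)) := (min_le_right _ _).trans (min_le_right _ _)
    rw [le_div_iff₀ (by positivity)] at e2
    have e3 : e ^ 2 ≤ e := by nlinarith
    calc C' * e ^ 2 * R ≤ C' * e * (R + 1) := by gcongr; linarith
      _ = e * (C' * (R + 1)) := by ring
      _ ≤ _ := e2
  have hη : 0 < min (ε / 4) (e0 ^ 2) := by positivity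
  obtain ⟨v2, w2, r2, a1, a2, a3⟩ := initial_step hR hv hvc hw Aec Aes AeB hc (by
    intro x hx a b
    rw [Ae1 0 0 x hx, Ae1 0 1 x hx, Ae1 1 1 x hx]
    exact hq x hx a b) hη
  obtain ⟨L, L0, hL⟩ := r2.lip
  -- extension of the defect
  have hpow : ∀ t : ℝ, 0 ≤ t → t ≤ 1 → t ≤ t ^ β := fun t ht ht1 => by
    have := Real.rpow_le_rpow_of_exponent_ge' ht ht1 hβ0.le hβ1.le
    rwa [Real.rpow_one] at this
  have hD : ∀ i j, ∀ x ∈ Ω, ∀ y ∈ Ω, |(A i j x - Df v2 w2 i j x) - (A i j y - Df v2 w2 i j y)|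
      ≤ (H + L + 2 * e0 ^ 2) * ‖x - y‖ ^ β := by
    intro i j x hx y hy
    have n0 : 0 ≤ ‖x - y‖ ^ β := by positivity
    by_cases h : ‖x - y‖ ≤ 1
    · have e : (A i j x - Df v2 w2 i j x) - (A i j y - Df v2 w2 i j y) =
        (A i j x - A i j y) - (Df v2 w2 i j x - Df v2 w2 i j y) := by ring
      rw [e]
      refine (abs_sub _ _).trans ((add_le_add (hH i j x hx y hy) (hL i j x y)).trans ?_)
      have := mul_le_mul_of_nonneg_left (hpow _ (norm_nonneg _) h) L0
      have : 0 ≤ 2 * e0 ^ 2 * ‖x - y‖ ^ β := by positivity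
      linarith
    · have h1 : 1 ≤ ‖x - y‖ ^ β := Real.one_le_rpow (not_le.1 h).le hβ0.le
      have q1 := a3 i j x hx
      have q2 := a3 i j y hy
      rw [Ae1 i j x hx] at q1
      rw [Ae1 i j y hy] at q2
      refine (abs_sub _ _).trans ((add_le_add q1 q2).trans ?_)
      have := min_le_right (ε / 4) (e0 ^ 2)
      have h2 : (H + L + 2 * e0 ^ 2) * 1 ≤ (H + L + 2 * e0 ^ 2) * ‖x - y‖ ^ β := by gcongr
      linarith
  have hext : ∀ i j, ∃ g : V2 → ℝ, (∀ x ∈ Ω, g x = A i j x - Df v2 w2 i j x) ∧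
      (∀ x y, |g x - g y| ≤ (H + L + 2 * e0 ^ 2) * ‖x - y‖ ^ β) ∧ ∀ x, |g x| ≤ e0 ^ 2 := fun i j =>
    mcshane hne (fun x => A i j x - Df v2 w2 i j x) (by positivity) hβ0 hβ1.le (hD i j)
      (fun x hx => by
        have := a3 i j x hx
        rw [Ae1 i j x hx] at this
        exact this.trans (min_le_right _ _))
  choose d0 d1 d2 d3 using hext
  set At : Fin 2 → Fin 2 → V2 → ℝ := fun i j x => Df v2 w2 i j x + (d0 i j x + d0 j i x) / 2 with hAt
  obtain ⟨hv2, hw2, c1, f1, f2, f3⟩ := id r2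
  have c10 : 0 ≤ c1 := (f1 0).nonneg
  obtain ⟨v', w', b1, b2, b3, b4, b5, b6, b7⟩ := hit e0 (ε / 4) (c1 + 1) c1
    (L + (H + L + 2 * e0 ^ 2)) v2 w2 At he0 he1 (by positivity) (by linarith) hv2 hw2
    (fun i j => (r2.cont i j).add
      (((cont_of _ _ (d2 i j)).add (cont_of _ _ (d2 j i))).div_const 2))
    (fun i j => by funext x; simp only [hAt]; rw [Df_symm v2 w2 i j]; ring)
    (fun i j x => by
      simp only [hAt]
      rw [add_sub_cancel_left, abs_div, abs_of_pos (zero_lt_two' ℝ), div_le_iff₀ zero_lt_two]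
      exact (abs_add_le _ _).trans (by linarith [d3 i j x, d3 j i x]))
    (fun i x y => by
      have := (f1 i).lip x y
      rwa [mul_one] at this)
    f3 (fun i x => ((f1 i).abs_le x).trans (by linarith)) (fun i j x => (f2 i j x).trans (by linarith))
    (fun i j x y hxy => by
      have q0 := hL i j x y
      have q1 := d2 i j x y
      have q2 := d2 j i x y
      have q3 := mul_le_mul_of_nonneg_left (hpow _ (norm_nonneg _) hxy) L0
      simp only [hAt]
      rw [abs_le] at q0 q1 q2 ⊢
      constructor <;> linarith [q0.1, q0.2, q1.1, q1.2, q2.1, q2.2])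
  refine ⟨v', w', b1, b2, fun x hx => ?_, fun j x hx => ?_, b5, b6, fun i j x hx => ?_⟩
  · have := abs_add_le (v' x - v2 x) (v2 x - v x)
    rw [sub_add_sub_cancel] at this
    linarith [b3 x, a1 x hx, min_le_left (ε / 4) (e0 ^ 2)]
  · have := abs_add_le (w' j x - w2 j x) (w2 j x - w j x)
    rw [sub_add_sub_cancel] at this
    have h1 : C' * e0 ^ 2 * ‖x‖ ≤ C' * e0 ^ 2 * R :=
      mul_le_mul_of_nonneg_left (hR x hx) (by positivity)
    linarith [b4 j x, a2 j x hx, min_le_left (ε / 4) (e0 ^ 2)]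
  · rw [b7 i j x]
    simp only [hAt]
    rw [d1 i j x hx, d1 j i x hx, hAs j i, Df_symm v2 w2 j i]; ring

lemma norm_le_norm2 (y : V2) : ‖y‖ ≤ norm2 y := by
  unfold norm2
  rw [pi_norm_le_iff_of_nonneg (Real.sqrt_nonneg _)]
  intro i
  refine Real.le_sqrt_of_sq_le ?_
  rw [Real.norm_eq_abs, sq_abs]
  exact Finset.single_le_sum (f := fun i => y i ^ 2) (fun i _ => sq_nonneg _) (Finset.mem_univ i)

lemma norm2_le (y : V2) : norm2 y ≤ 2 * ‖y‖ := by
  unfold norm2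
  refine Real.sqrt_le_iff.2 ⟨by positivity, ?_⟩
  have h : ∀ i, y i ^ 2 ≤ ‖y‖ ^ 2 := fun i => by
    rw [← sq_abs]; exact pow_le_pow_left₀ (abs_nonneg _) (norm_le_pi_norm y i) 2
  simp only [Fin.sum_univ_two]
  nlinarith [h 0, h 1, sq_nonneg ‖y‖]

lemma le_frob (M : Mat2) (i j : Fin 2) : |M i j| ≤ frob M := by
  unfold frob
  refine Real.le_sqrt_of_sq_le ?_
  rw [sq_abs]
  have h1 := Finset.single_le_sum (f := fun j => M i j ^ 2) (fun j _ => sq_nonneg _) (Finset.mem_univ j)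
  have h2 := Finset.single_le_sum (f := fun i => ∑ j, M i j ^ 2)
    (fun i _ => Finset.sum_nonneg fun j _ => sq_nonneg _) (Finset.mem_univ i)
  exact h1.trans h2

lemma Dm_apply {w : V2 → V2} {x : V2} (hw : DifferentiableAt ℝ w x) (i j : Fin 2) :
    Dm w x i j = pd j (fun y => w y i) x := by
  have h := hasFDerivAt_pi'.1 hw.hasFDerivAt i
  simp only [Dm, pd, Matrix.of_apply]
  rw [h.fderiv]; rfl

lemma form_apply {v : V2 → ℝ} {w : V2 → V2} {x : V2} (hw : DifferentiableAt ℝ w x) (i j : Fin 2) :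
    ((2:ℝ) • symGrad w x + gradOuter v x) i j = Df v (fun j y => w y j) i j x := by
  simp only [symGrad, gradOuter, Df, Matrix.add_apply, Matrix.smul_apply, Matrix.transpose_apply,
    Dm_apply hw, Matrix.of_apply, smul_eq_mul]
  ring

lemma c1h_scalar {α : ℝ} (hα0 : 0 ≤ α) {f : V2 → ℝ}
    (h : ∃ Hc, ∀ i x y, |pd i f x - pd i f y| ≤ Hc * ‖x - y‖ ^ α) :
    ∃ C, 0 ≤ C ∧ ∀ x y, ‖fderiv ℝ f x - fderiv ℝ f y‖ ≤ C * norm2 (x - y) ^ α := by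
  obtain ⟨Hc, h⟩ := h
  refine ⟨2 * |Hc|, by positivity, fun x y => ?_⟩
  rw [fderiv_phase, fderiv_phase, phase_sub]
  have : ∀ i, |((fun i => pd i f x) - fun i => pd i f y : V2) i| ≤ |Hc| * norm2 (x - y) ^ α := by
    intro i
    refine (h i x y).trans ?_
    exact mul_le_mul (le_abs_self _) (Real.rpow_le_rpow (norm_nonneg _) (norm_le_norm2 _) hα0)
      (by positivity) (abs_nonneg _)
  exact (norm_phase _ this).trans (le_of_eq (by ring))

/-- Corollary: the `C^{1,α}` h-principle for strictly short data. -/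
theorem vonKarman_C1alpha_hprinciple_short
    (Ω : Set V2) (hΩo : IsOpen Ω) (hΩb : Bornology.IsBounded Ω)
    (hΩsc : SimplyConnectedSpace Ω) (hΩsm : HasSmoothBoundary Ω)
    (β : ℝ) (hβ : β ∈ Set.Ioo (0 : ℝ) 1)
    (α : ℝ) (hα0 : 0 < α) (hα : α < min (1/7 : ℝ) (β/2))
    (A : V2 → Mat2) (hAsymm : ∀ x, (A x).IsSymm) (hA : HolderCl β Ω A)
    (v : V2 → ℝ) (w : V2 → V2) (hv : CkCl 1 Ω v) (hw : CkCl 1 Ω w)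
    (c : ℝ) (hc : 0 < c)
    (hshort : ∀ x ∈ Ω,
      (A x - c • (1 : Mat2) - ((2:ℝ) • symGrad w x + gradOuter v x)).PosSemidef)
    (ε : ℝ) (hε : 0 < ε) :
    ∃ (v' : V2 → ℝ) (w' : V2 → V2),
      C1Holder α Ω v' ∧ C1Holder α Ω w' ∧
      supV Ω (fun x => w' x - w x) + supS Ω (fun x => v' x - v x) ≤ ε ∧
      ∀ x ∈ Ω, (2:ℝ) • symGrad w' x + gradOuter v' x = A x := by
  obtain ⟨hβ0, hβ1⟩ := hβ
  have hne : Ω.Nonempty := by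
    have : Nonempty Ω := inferInstance
    exact Set.nonempty_coe_sort.1 this
  have hK : IsCompact (closure Ω) := hΩb.isCompact_closure
  obtain ⟨R, hR⟩ := hΩb.exists_norm_le
  obtain ⟨U, hU, hUK, hvU⟩ := hv
  obtain ⟨U', hU', hUK', hwU⟩ := hw
  have hvU1 : ContDiffOn ℝ 1 v U := by simpa using hvU
  have hwU1 : ContDiffOn ℝ 1 w U' := by simpa using hwU
  obtain ⟨F, F1, F2, F3⟩ := cut_C1 hK hU hUK hvU1
  have : ∀ j, ∃ G : V2 → ℝ, ContDiff ℝ 1 G ∧ HasCompactSupport G ∧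
      ∀ x ∈ closure Ω, G =ᶠ[𝓝 x] fun y => w y j := fun j =>
    cut_C1 hK hU' hUK' (contDiffOn_pi.1 hwU1 j)
  choose W W1 W2 W3 using this
  have hwd : ∀ x ∈ Ω, DifferentiableAt ℝ w x := fun x hx =>
    (hwU1.contDiffAt (hU'.mem_nhds (hUK' (subset_closure hx)))).differentiableAt (by norm_num)
  have hDf : ∀ i j, ∀ x ∈ Ω, Df F W i j x = Df v (fun j y => w y j) i j x := by
    intro i j x hx
    have hx' := subset_closure hx
    simp only [Df, pd_congr (F3 x hx'), pd_congr (W3 _ x hx')]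
  obtain ⟨H, hH⟩ := hA
  obtain ⟨v', w', b1, b2, b3, b4, b5, b6, b7⟩ := core α β hβ0 hβ1 hα0 hα hne hR F1 F2 W1
    (A := fun i j x => A x i j) (H := |H| * 2 ^ β) (c := c)
    (fun i j => by funext x; exact (hAsymm x).apply j i)
    (fun i j x hx y hy => by
      have h1 := hH x (subset_closure hx) y (subset_closure hy)
      have h2 := le_frob (A x - A y) i j
      rw [Matrix.sub_apply] at h2
      refine h2.trans (h1.trans ?_)
      rw [mul_assoc, ← Real.mul_rpow (by norm_num) (norm_nonneg _)]
      exact mul_le_mul (le_abs_self _) (Real.rpow_le_rpow (Real.sqrt_nonneg _) (norm2_le _) hβ0.le)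
        (Real.rpow_nonneg (Real.sqrt_nonneg _) _) (abs_nonneg _)) hc
    (fun x hx a b => by
      have h := (hshort x hx).dotProduct_mulVec_nonneg ![a, b]
      have e : ∀ i j, (A x - c • (1 : Mat2) - ((2:ℝ) • symGrad w x + gradOuter v x)) i j =
          A x i j - Df F W i j x - c * (1 : Mat2) i j := by
        intro i j
        rw [Matrix.sub_apply, form_apply (hwd x hx), hDf i j x hx]
        simp only [Matrix.sub_apply, Matrix.smul_apply, smul_eq_mul]
        ring
      simp only [dotProduct, Matrix.mulVec, Fin.sum_univ_two, e] at h
      simp at h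
      have h10 : A x 1 0 = A x 0 1 := (hAsymm x).apply 0 1
      have d10 : Df F W 1 0 x = Df F W 0 1 x := by rw [Df_symm]
      rw [h10, d10] at h
      nlinarith)
    (ε := ε / 4) (by positivity)
  have hdw : Differentiable ℝ (fun x j => w' j x : V2 → V2) := differentiable_pi.2 b2
  refine ⟨v', fun x j => w' j x, ⟨b1.continuous.continuousOn, b1.differentiableOn, ?_⟩,
    ⟨hdw.continuous.continuousOn, hdw.differentiableOn, ?_⟩, ?_, ?_⟩
  · obtain ⟨C, -, hC⟩ := c1h_scalar hα0.le b5
    exact ⟨C, fun x _ y _ => hC x y⟩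
  · have := fun j => c1h_scalar hα0.le (b6 j)
    choose C C0 hC using this
    refine ⟨C 0 + C 1, fun x _ y _ => ?_⟩
    have n0 : 0 ≤ norm2 (x - y) ^ α := Real.rpow_nonneg (Real.sqrt_nonneg _) _
    have c0 := C0 0
    have c1 := C0 1
    refine ContinuousLinearMap.opNorm_le_bound _ (by positivity) fun z => ?_
    rw [pi_norm_le_iff_of_nonneg (by positivity)]
    intro j
    have hfd : ∀ x, fderiv ℝ (fun x j => w' j x : V2 → V2) x z j = fderiv ℝ (w' j) x z := by
      intro x
      have h := hasFDerivAt_pi'.1 (hdw x).hasFDerivAt j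
      rw [h.fderiv]; rfl
    have e : (fderiv ℝ (fun x j => w' j x : V2 → V2) x - fderiv ℝ (fun x j => w' j x : V2 → V2) y) z j
        = (fderiv ℝ (w' j) x - fderiv ℝ (w' j) y) z := by
      simp only [ContinuousLinearMap.sub_apply, Pi.sub_apply, hfd]
    rw [e]
    refine (ContinuousLinearMap.le_opNorm _ _).trans ?_
    refine mul_le_mul_of_nonneg_right ((hC j x y).trans ?_) (norm_nonneg _)
    refine mul_le_mul_of_nonneg_right ?_ n0
    fin_cases j
    · change C 0 ≤ _; linarith
    · change C 1 ≤ _; linarith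
  · have s1 : supV Ω (fun x => (fun j => w' j x) - w x) ≤ ε / 2 := by
      refine Real.iSup_le (fun x => (norm2_le _).trans ?_) (by positivity)
      have : ‖(fun j => w' j x) - w x‖ ≤ ε / 4 := by
        rw [pi_norm_le_iff_of_nonneg (by positivity)]
        intro j
        have h1 := b4 j x x.2
        rw [(W3 j x (subset_closure x.2)).self_of_nhds] at h1
        exact h1
      linarith
    have s2 : supS Ω (fun x => v' x - v x) ≤ ε / 4 := by
      refine Real.iSup_le (fun x => ?_) (by positivity)
      have h1 := b3 x x.2
      rw [(F3 x (subset_closure x.2)).self_of_nhds] at h1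
      exact h1
    linarith
  · intro x hx
    ext i j
    rw [form_apply (hdw x)]
    exact b7 i j x hx
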